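/- Let 13/14 < γ < 1 be fixed and ε > 0. Suppose α is irrational and β is real, and a, q are integers with q ≥ 2, gcd(a,q) = 1, a ≠ 0 and |α − a/q| < 1/q². Set N = q^{29/(55−28γ)} and Δ = C N^{(13−14γ)/29 + ε} for a sufficiently large constant C > 0. Then for q sufficiently large, Γ = Σ_{p ≤ N, p = ⌊n^{1/γ}⌋ for some positive integer n} ( F_Δ(αp² + β) − 2Δ ) log p satisfies Γ ≪ N^{(15γ+13)/29 + ε}, where the sum is over primes p ≤ N of the indicated form. -/

import Mathlib

/-- `Fdelta Δ` is the 1-periodic function equal to `1` on `[-Δ, Δ)` and `0` on the rest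
of `[-1/2, 1/2)` (using the representative of `θ` modulo one lying in `[-1/2, 1/2)`). -/
noncomputable def Fdelta (Δ θ : ℝ) : ℝ :=
  if -Δ ≤ Int.fract (θ + 1 / 2) - 1 / 2 ∧ Int.fract (θ + 1 / 2) - 1 / 2 < Δ then 1 else 0

open Classical in
/-- The Piatetski-Shapiro primes of type `γ` up to `N`. -/
noncomputable def psPrimes (γ N : ℝ) : Finset ℕ :=
  (Finset.range (⌊N⌋₊ + 1)).filter
    (fun p => p.Prime ∧ ∃ n : ℕ, 0 < n ∧ p = ⌊(n : ℝ) ^ (1 / γ)⌋₊)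

open Finset in
theorem sum_inv_sq_Icc_le (z : ℕ) : ∑ s ∈ Icc 1 z, 1 / (s : ℝ) ^ 2 ≤ 2 := by
  suffices h : ∀ z : ℕ, ∑ s ∈ Icc 1 (z + 1), 1 / (s : ℝ) ^ 2 ≤ 2 - 1 / ((z : ℝ) + 1) by
    rcases z with _ | z
    · simp
    · exact (h z).trans (by linarith [show (0 : ℝ) ≤ 1 / ((z : ℝ) + 1) by positivity])
  intro z
  induction z with
  | zero => norm_num
  | succ n ih =>
    rw [sum_Icc_succ_top (by omega)]
    have h1 : 1 / (((n + 1 + 1 : ℕ) : ℝ)) ^ 2 ≤ 1 / ((n : ℝ) + 1) - 1 / ((n : ℝ) + 1 + 1) := by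
      push_cast
      rw [div_sub_div _ _ (by positivity) (by positivity), div_le_div_iff₀ (by positivity)
        (by positivity)]
      nlinarith [(Nat.cast_nonneg n : (0 : ℝ) ≤ n)]
    push_cast at h1 ⊢
    linarith

open Finset in
/-- The sum of `1 / r` over squarefree `r ≤ z` is at least `log (z + 1) / 2`. -/
theorem log_le_sum_squarefree_inv (z : ℕ) :
    Real.log (z + 1) / 2 ≤ ∑ r ∈ Icc 1 z with Squarefree r, 1 / (r : ℝ) := by
  have h1 : Real.log (z + 1) ≤ ∑ n ∈ Icc 1 z, 1 / (n : ℝ) := by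
    have := log_add_one_le_harmonic z
    rw [harmonic_eq_sum_Icc] at this
    push_cast at this
    simpa using this
  have h2 : ∑ n ∈ Icc 1 z, 1 / (n : ℝ) ≤
      ∑ x ∈ Icc 1 z ×ˢ (Icc 1 z).filter Squarefree, 1 / (x.1 : ℝ) ^ 2 * (1 / (x.2 : ℝ)) := by
    choose a b hab hsq using Nat.sq_mul_squarefree
    have hpos : ∀ n ∈ Icc 1 z, 0 < a n ∧ 0 < b n := by
      intro n hn
      have h := hab n
      rw [mem_Icc] at hn
      constructor <;> rw [Nat.pos_iff_ne_zero] <;> intro h0 <;> rw [h0] at h <;> simp at h <;> omega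
    calc ∑ n ∈ Icc 1 z, 1 / (n : ℝ)
        = ∑ n ∈ Icc 1 z, 1 / (b n : ℝ) ^ 2 * (1 / (a n : ℝ)) := by
          refine sum_congr rfl fun n _ => ?_
          conv_lhs => rw [← hab n]
          push_cast
          rw [one_div_mul_one_div]
      _ = ∑ x ∈ (Icc 1 z).image (fun n => (b n, a n)), 1 / (x.1 : ℝ) ^ 2 * (1 / (x.2 : ℝ)) := by
          rw [sum_image]
          intro n _ m _ h
          simp only [Prod.mk.injEq] at h
          rw [← hab n, ← hab m, h.1, h.2]
      _ ≤ _ := by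
          refine sum_le_sum_of_subset_of_nonneg ?_ fun _ _ _ => by positivity
          intro x hx
          obtain ⟨n, hn, rfl⟩ := mem_image.1 hx
          have hp := hpos n hn
          have hn' := (mem_Icc.1 hn).2
          have h := hab n
          simp only [mem_product, mem_filter, mem_Icc]
          refine ⟨⟨hp.2, ?_⟩, ⟨hp.1, ?_⟩, hsq n⟩
          · nlinarith [Nat.le_self_pow (two_ne_zero) (b n)]
          · nlinarith [Nat.one_le_pow 2 (b n) hp.2]
  rw [sum_product] at h2
  dsimp only at h2
  rw [← sum_mul_sum] at h2
  have h3 : 0 ≤ ∑ r ∈ Icc 1 z with Squarefree r, 1 / (r : ℝ) :=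
    sum_nonneg fun _ _ => by positivity
  nlinarith [sum_inv_sq_Icc_le z]

open Finset ArithmeticFunction in
theorem sum_moebius_div_between {r s : ℕ} (z : ℕ) (hs : 1 ≤ s) (hsz : s ≤ z) (hr : r ∣ s) :
    ∑ d ∈ Icc 1 z with r ∣ d ∧ d ∣ s, (moebius (s / d) : ℝ) = if r = s then 1 else 0 := by
  obtain ⟨t, rfl⟩ := hr
  have hr0 : 0 < r := Nat.pos_of_mul_pos_right hs
  have ht0 : 0 < t := Nat.pos_of_mul_pos_left hs
  have key : ∑ d ∈ Icc 1 z with r ∣ d ∧ d ∣ r * t, (moebius (r * t / d) : ℝ) =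
      ∑ e ∈ t.divisors, (moebius (t / e) : ℝ) := by
    symm
    refine sum_bij (fun e _ => r * e) ?_ ?_ ?_ ?_
    · intro e he
      have hd := Nat.dvd_of_mem_divisors he
      have := Nat.le_of_dvd ht0 hd
      have he0 := Nat.pos_of_mem_divisors he
      simp only [mem_filter, mem_Icc]
      exact ⟨⟨Nat.mul_pos hr0 he0, (Nat.mul_le_mul_left r this).trans hsz⟩, dvd_mul_right _ _,
        Nat.mul_dvd_mul_left r hd⟩
    · intro e _ e' _ h
      exact Nat.eq_of_mul_eq_mul_left hr0 h
    · intro d hd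
      simp only [mem_filter, mem_Icc] at hd
      obtain ⟨_, ⟨e, rfl⟩, hd⟩ := hd
      exact ⟨e, Nat.mem_divisors.2 ⟨Nat.dvd_of_mul_dvd_mul_left hr0 hd, ht0.ne'⟩, rfl⟩
    · intro e _
      rw [Nat.mul_div_mul_left _ _ hr0]
  rw [key, Nat.sum_div_divisors t (fun e => (moebius e : ℝ))]
  have h := congrArg (fun f : ArithmeticFunction ℤ => f t) moebius_mul_coe_zeta
  simp only [coe_mul_zeta_apply, one_apply] at h
  have h' : ∑ e ∈ t.divisors, (moebius e : ℝ) = if t = 1 then 1 else 0 := by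
    exact_mod_cast h
  rw [h']
  congr 1
  simp only [eq_iff_iff]
  constructor
  · rintro rfl; simp
  · intro h; exact Nat.eq_of_mul_eq_mul_left hr0 (by omega)

open Finset ArithmeticFunction in
/-- Selberg's weights: they make the quadratic form attached to the upper bound sieve small. -/
theorem exists_selberg_weights (z : ℕ) (hz : 1 ≤ z) :
    ∃ l : ℕ → ℝ, l 1 = 1 ∧ (∀ d ∈ Icc 1 z, |l d| ≤ (z : ℝ) ^ 2) ∧
      ∑ d ∈ Icc 1 z, ∑ e ∈ Icc 1 z, l d * l e / (Nat.lcm d e : ℝ) ≤ 2 / Real.log (z + 1) := by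
  set V : ℝ := ∑ r ∈ Icc 1 z, (moebius r : ℝ) ^ 2 / (Nat.totient r : ℝ) with hV
  have hVlog : Real.log (z + 1) / 2 ≤ V := by
    refine (log_le_sum_squarefree_inv z).trans ?_
    rw [sum_filter]
    refine sum_le_sum fun r hr => ?_
    have hr1 := (mem_Icc.1 hr).1
    have hphi : (0 : ℝ) < Nat.totient r := by exact_mod_cast Nat.totient_pos.2 hr1
    split_ifs with h
    · have : (moebius r : ℝ) ^ 2 = 1 := by
        exact_mod_cast moebius_sq_eq_one_of_squarefree h
      rw [this]
      exact one_div_le_one_div_of_le hphi (by exact_mod_cast Nat.totient_le r)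
    · positivity
  have hV1 : 1 ≤ V := by
    have : (moebius 1 : ℝ) ^ 2 / (Nat.totient 1 : ℝ) ≤ V :=
      single_le_sum (f := fun r : ℕ => (moebius r : ℝ) ^ 2 / (Nat.totient r : ℝ))
        (fun _ _ => by positivity) (mem_Icc.2 ⟨le_rfl, hz⟩)
    simpa using this
  have hV0 : 0 < V := by linarith
  set y : ℕ → ℝ := fun r => (moebius r : ℝ) / Nat.totient r / V with hy
  set l : ℕ → ℝ := fun d => d * ∑ r ∈ Icc 1 z with d ∣ r, (moebius (r / d) : ℝ) * y r with hl
  have hmu : ∀ n : ℕ, |(moebius n : ℝ)| ≤ 1 := fun n => by exact_mod_cast abs_moebius_le_one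
  have hyb : ∀ r ∈ Icc 1 z, |y r| ≤ 1 := by
    intro r hr
    have hphi : (1 : ℝ) ≤ Nat.totient r := by
      exact_mod_cast Nat.totient_pos.2 (mem_Icc.1 hr).1
    rw [hy]
    simp only [abs_div]
    rw [abs_of_pos hV0, abs_of_nonneg (by positivity : (0 : ℝ) ≤ Nat.totient r), div_div,
      div_le_one (by positivity)]
    nlinarith [hmu r]
  have hinv : ∀ r ∈ Icc 1 z, ∑ d ∈ Icc 1 z with r ∣ d, l d / d = y r := by
    intro r hr
    calc ∑ d ∈ Icc 1 z with r ∣ d, l d / d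
        = ∑ d ∈ Icc 1 z with r ∣ d, ∑ s ∈ Icc 1 z with d ∣ s, (moebius (s / d) : ℝ) * y s := by
          refine sum_congr rfl fun d hd => ?_
          have : (d : ℝ) ≠ 0 := by
            have := (mem_Icc.1 (mem_filter.1 hd).1).1
            positivity
          rw [hl]
          field_simp
      _ = ∑ s ∈ Icc 1 z with r ∣ s, ∑ d ∈ Icc 1 z with r ∣ d ∧ d ∣ s,
            (moebius (s / d) : ℝ) * y s := by
          refine sum_comm' fun d s => ?_
          simp only [mem_filter]
          constructor
          · rintro ⟨⟨h1, h2⟩, h3, h4⟩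
            exact ⟨⟨h1, h2, h4⟩, h3, h2.trans h4⟩
          · rintro ⟨⟨h1, h2, h4⟩, h3, _⟩
            exact ⟨⟨h1, h2⟩, h3, h4⟩
      _ = ∑ s ∈ Icc 1 z with r ∣ s, if r = s then y s else 0 := by
          refine sum_congr rfl fun s hs => ?_
          rw [mem_filter, mem_Icc] at hs
          rw [← sum_mul, sum_moebius_div_between z hs.1.1 hs.1.2 hs.2]
          split_ifs <;> simp
      _ = y r := by
          rw [sum_ite_eq, if_pos]
          simp [mem_filter, hr]
  refine ⟨l, ?_, ?_, ?_⟩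
  · simp only [hl, hy, Nat.cast_one, one_mul, Nat.div_one, one_dvd, filter_true]
    rw [sum_congr rfl (g := fun r : ℕ => (moebius r : ℝ) ^ 2 / (Nat.totient r : ℝ) / V)
      (fun r _ => by ring), ← sum_div, ← hV, div_self hV0.ne']
  · intro d hd
    simp only [hl]
    rw [abs_mul, sq, Nat.abs_cast]
    refine mul_le_mul (by exact_mod_cast (mem_Icc.1 hd).2) ?_ (abs_nonneg _) (by positivity)
    calc |∑ r ∈ Icc 1 z with d ∣ r, (moebius (r / d) : ℝ) * y r|
        ≤ ∑ r ∈ Icc 1 z with d ∣ r, |(moebius (r / d) : ℝ) * y r| := abs_sum_le_sum_abs _ _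
      _ ≤ ∑ r ∈ Icc 1 z with d ∣ r, (1 : ℝ) := by
          refine sum_le_sum fun r hr => ?_
          rw [abs_mul]
          exact mul_le_one₀ (hmu _) (abs_nonneg _) (hyb r (mem_filter.1 hr).1)
      _ ≤ z := by
          rw [sum_const, nsmul_eq_mul, mul_one]
          exact_mod_cast (card_filter_le _ _).trans (by simp)
  · calc ∑ d ∈ Icc 1 z, ∑ e ∈ Icc 1 z, l d * l e / (Nat.lcm d e : ℝ)
        = ∑ d ∈ Icc 1 z, ∑ e ∈ Icc 1 z, ∑ r ∈ Icc 1 z with r ∣ d ∧ r ∣ e,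
            (Nat.totient r : ℝ) * (l d / d) * (l e / e) := by
          refine sum_congr rfl fun d hd => sum_congr rfl fun e he => ?_
          rw [mem_Icc] at hd he
          have hset : (Icc 1 z).filter (fun r => r ∣ d ∧ r ∣ e) = (Nat.gcd d e).divisors := by
            ext r
            simp only [mem_filter, mem_Icc, Nat.mem_divisors, Nat.dvd_gcd_iff]
            constructor
            · rintro ⟨_, h⟩
              exact ⟨h, (Nat.gcd_pos_of_pos_left e hd.1).ne'⟩
            · rintro ⟨h, _⟩
              exact ⟨⟨Nat.pos_of_dvd_of_pos h.1 hd.1, (Nat.le_of_dvd hd.1 h.1).trans hd.2⟩, h⟩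
          rw [hset]
          simp only [mul_assoc]
          rw [← sum_mul]
          have h1 : ∑ r ∈ (Nat.gcd d e).divisors, (Nat.totient r : ℝ) = Nat.gcd d e := by
            exact_mod_cast Nat.sum_totient (Nat.gcd d e)
          have h2 : (Nat.gcd d e : ℝ) * Nat.lcm d e = d * e := by
            exact_mod_cast Nat.gcd_mul_lcm d e
          have hd0 : (d : ℝ) ≠ 0 := by have := hd.1; positivity
          have he0 : (e : ℝ) ≠ 0 := by have := he.1; positivity
          have hl0 : (Nat.lcm d e : ℝ) ≠ 0 := by
            intro h
            rw [h, mul_zero] at h2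
            exact mul_ne_zero hd0 he0 h2.symm
          rw [h1]
          field_simp
          linear_combination (-(l d * l e)) * h2
      _ = ∑ r ∈ Icc 1 z, ∑ d ∈ Icc 1 z with r ∣ d, ∑ e ∈ Icc 1 z with r ∣ e,
            (Nat.totient r : ℝ) * (l d / d) * (l e / e) := by
          simp only [sum_filter]
          rw [sum_congr rfl fun d _ => sum_comm, sum_comm]
          refine sum_congr rfl fun r _ => sum_congr rfl fun d _ => ?_
          by_cases h : r ∣ d <;> simp [h]
      _ = ∑ r ∈ Icc 1 z, (Nat.totient r : ℝ) * y r ^ 2 := by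
          refine sum_congr rfl fun r hr => ?_
          rw [← hinv r hr, sq, sum_mul_sum, mul_sum]
          refine sum_congr rfl fun d _ => ?_
          rw [mul_sum]
          exact sum_congr rfl fun e _ => by ring
      _ = 1 / V := by
          have : ∀ r ∈ Icc 1 z, (Nat.totient r : ℝ) * y r ^ 2 =
              ((moebius r : ℝ) ^ 2 / Nat.totient r) / V ^ 2 := by
            intro r hr
            have hphi : (Nat.totient r : ℝ) ≠ 0 := by
              exact_mod_cast (Nat.totient_pos.2 (mem_Icc.1 hr).1).ne'
            simp only [hy]
            field_simp
          rw [sum_congr rfl this, ← sum_div, ← hV]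
          field_simp
      _ ≤ 2 / Real.log (z + 1) := by
          have hlog : 0 < Real.log (z + 1) := Real.log_pos (by
            have : (1 : ℝ) ≤ z := by exact_mod_cast hz
            linarith)
          rw [div_le_div_iff₀ hV0 hlog]
          linarith

open Finset in
/-- Selberg's upper bound sieve for primes, for a weight that is equidistributed in the
residue class zero to small moduli. -/
theorem sum_primes_le_of_equidistributed (S : Finset ℕ) (w : ℕ → ℝ) (hw : ∀ m ∈ S, 0 ≤ w m)
    (X E : ℝ) (hE : ∀ r : ℕ, 1 ≤ r → |∑ m ∈ S with r ∣ m, w m - X / r| ≤ E) (hX : 0 ≤ X)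
    (z : ℕ) (hz : 1 ≤ z) :
    ∑ p ∈ S with p.Prime ∧ z < p, w p ≤ 2 * X / Real.log (z + 1) + (z : ℝ) ^ 6 * E := by
  obtain ⟨l, hl1, hlb, hq⟩ := exists_selberg_weights z hz
  have hE0 : 0 ≤ E := (abs_nonneg _).trans (hE 1 le_rfl)
  calc ∑ p ∈ S with p.Prime ∧ z < p, w p
      ≤ ∑ m ∈ S, w m * (∑ d ∈ Icc 1 z with d ∣ m, l d) ^ 2 := by
        rw [sum_filter]
        refine sum_le_sum fun m hm => ?_
        split_ifs with h
        · have : (Icc 1 z).filter (fun d => d ∣ m) = {1} := by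
            ext d
            simp only [mem_filter, mem_Icc, mem_singleton]
            constructor
            · rintro ⟨⟨h1, h2⟩, h3⟩
              rcases (Nat.dvd_prime h.1).1 h3 with h4 | h4
              · exact h4
              · omega
            · rintro rfl
              exact ⟨⟨le_rfl, hz⟩, one_dvd _⟩
          rw [this, sum_singleton, hl1]
          simp
        · exact mul_nonneg (hw m hm) (sq_nonneg _)
    _ = ∑ d ∈ Icc 1 z, ∑ e ∈ Icc 1 z, l d * l e * ∑ m ∈ S with Nat.lcm d e ∣ m, w m := by
        have h1 : ∀ m ∈ S, w m * (∑ d ∈ Icc 1 z with d ∣ m, l d) ^ 2 =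
            ∑ d ∈ Icc 1 z, ∑ e ∈ Icc 1 z, if Nat.lcm d e ∣ m then l d * l e * w m else 0 := by
          intro m _
          rw [sq, sum_filter, sum_mul_sum, mul_sum]
          refine sum_congr rfl fun d _ => ?_
          rw [mul_sum]
          refine sum_congr rfl fun e _ => ?_
          by_cases h1 : d ∣ m <;> by_cases h2 : e ∣ m <;> simp [Nat.lcm_dvd_iff, h1, h2]
          ring
        rw [sum_congr rfl h1, sum_comm]
        refine sum_congr rfl fun d _ => ?_
        rw [sum_comm]
        refine sum_congr rfl fun e _ => ?_
        rw [sum_filter, mul_sum]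
        exact sum_congr rfl fun m _ => by split_ifs <;> simp
    _ ≤ ∑ d ∈ Icc 1 z, ∑ e ∈ Icc 1 z, (X * (l d * l e / (Nat.lcm d e : ℝ)) + (z : ℝ) ^ 4 * E) := by
        refine sum_le_sum fun d hd => sum_le_sum fun e he => ?_
        have h1 := hE (Nat.lcm d e) (Nat.lcm_pos (mem_Icc.1 hd).1 (mem_Icc.1 he).1)
        set A := ∑ m ∈ S with Nat.lcm d e ∣ m, w m
        have h2 : l d * l e * A = X * (l d * l e / (Nat.lcm d e : ℝ)) +
            l d * l e * (A - X / (Nat.lcm d e : ℕ)) := by ring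
        rw [h2]
        refine add_le_add_right ?_ _
        refine (le_abs_self _).trans ?_
        rw [abs_mul, abs_mul]
        refine mul_le_mul ?_ h1 (abs_nonneg _) (by positivity)
        calc |l d| * |l e| ≤ (z : ℝ) ^ 2 * (z : ℝ) ^ 2 :=
              mul_le_mul (hlb d hd) (hlb e he) (abs_nonneg _) (by positivity)
          _ = (z : ℝ) ^ 4 := by ring
    _ = X * ∑ d ∈ Icc 1 z, ∑ e ∈ Icc 1 z, l d * l e / (Nat.lcm d e : ℝ) + (z : ℝ) ^ 6 * E := by
        simp only [sum_add_distrib, ← mul_sum, sum_const, Nat.card_Icc, nsmul_eq_mul]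
        push_cast [Nat.add_sub_cancel]
        ring
    _ ≤ 2 * X / Real.log (z + 1) + (z : ℝ) ^ 6 * E := by
        have := mul_le_mul_of_nonneg_left hq hX
        have h2 : X * (2 / Real.log (z + 1)) = 2 * X / Real.log (z + 1) := by ring
        linarith

/-- The additive character `x ↦ exp (2 π i x)`. -/
noncomputable def unitExp (x : ℝ) : ℂ := Complex.exp ((2 * Real.pi * x : ℝ) * Complex.I)

theorem norm_unitExp (x : ℝ) : ‖unitExp x‖ = 1 := Complex.norm_exp_ofReal_mul_I _

theorem unitExp_add (x y : ℝ) : unitExp (x + y) = unitExp x * unitExp y := by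
  rw [unitExp, unitExp, unitExp, ← Complex.exp_add]
  congr 1
  push_cast
  ring

theorem unitExp_zero : unitExp 0 = 1 := by simp [unitExp]

theorem conj_unitExp (x : ℝ) : (starRingEnd ℂ) (unitExp x) = unitExp (-x) := by
  rw [unitExp, unitExp, ← Complex.exp_conj, map_mul, Complex.conj_ofReal, Complex.conj_I]
  congr 1
  push_cast
  ring

theorem unitExp_int (n : ℤ) : unitExp n = 1 := by
  rw [unitExp, Complex.exp_eq_one_iff]
  exact ⟨n, by push_cast; ring⟩

theorem unitExp_nat_mul (n : ℕ) (x : ℝ) : unitExp (n * x) = unitExp x ^ n := by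
  rw [unitExp, unitExp, ← Complex.exp_nat_mul]
  congr 1
  push_cast
  ring

theorem re_unitExp (x : ℝ) : (unitExp x).re = Real.cos (2 * Real.pi * x) :=
  Complex.exp_ofReal_mul_I_re _

theorem norm_unitExp_sub_one (x : ℝ) : ‖unitExp x - 1‖ = 2 * |Real.sin (Real.pi * x)| := by
  rw [unitExp, mul_comm, Complex.norm_exp_I_mul_ofReal_sub_one, Real.norm_eq_abs, abs_mul,
    abs_two]
  congr 3
  ring

theorem unitExp_sub_int (x : ℝ) (n : ℤ) : unitExp (x - n) = unitExp x := by
  have h := unitExp_add (x - n) n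
  rw [unitExp_int, mul_one, sub_add_cancel] at h
  exact h.symm

theorem four_mul_abs_le_norm_unitExp_sub_one {x : ℝ} (hx : |x| ≤ 1 / 2) :
    4 * |x| ≤ ‖unitExp x - 1‖ := by
  have hpi := Real.pi_pos
  rw [norm_unitExp_sub_one]
  have h1 : |Real.sin (Real.pi * x)| = |Real.sin (Real.pi * |x|)| := by
    rcases abs_choice x with h | h <;> rw [h]
    rw [mul_neg, Real.sin_neg, abs_neg]
  have h2 := Real.mul_le_sin (x := Real.pi * |x|) (by positivity) (by nlinarith)
  have h3 : 2 / Real.pi * (Real.pi * |x|) = 2 * |x| := by field_simp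
  rw [h1]
  linarith [le_abs_self (Real.sin (Real.pi * |x|))]

theorem four_mul_abs_sub_round_le (x : ℝ) : 4 * |x - round x| ≤ ‖unitExp x - 1‖ := by
  have := four_mul_abs_le_norm_unitExp_sub_one (abs_sub_round x)
  rwa [unitExp_sub_int] at this

theorem norm_unitExp_sub_unitExp_le (x y : ℝ) :
    ‖unitExp x - unitExp y‖ ≤ 2 * Real.pi * |x - y| := by
  have hpi := Real.pi_pos
  have h : unitExp x - unitExp y = unitExp y * (unitExp (x - y) - 1) := by
    rw [mul_sub, ← unitExp_add, mul_one, add_sub_cancel]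
  rw [h, norm_mul, norm_unitExp, one_mul, norm_unitExp_sub_one]
  have := Real.abs_sin_le_abs (x := Real.pi * (x - y))
  rw [abs_mul, abs_of_pos hpi] at this
  linarith

open Finset in
theorem norm_sum_unitExp_le (s : Finset ℕ) (F : ℕ → ℝ) : ‖∑ l ∈ s, unitExp (F l)‖ ≤ #s := by
  refine (norm_sum_le _ _).trans ?_
  simp [norm_unitExp]

open Finset in
theorem norm_sum_unitExp_linear_le (θ c : ℝ) (n : ℕ) {η : ℝ} (hη : 0 < η)
    (h : η ≤ |θ - round θ|) : ‖∑ l ∈ range n, unitExp (θ * l + c)‖ ≤ 1 / (2 * η) := by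
  have h1 : ∑ l ∈ range n, unitExp (θ * l + c) = (∑ l ∈ range n, unitExp θ ^ l) * unitExp c := by
    rw [sum_mul]
    refine sum_congr rfl fun l _ => ?_
    rw [unitExp_add, mul_comm θ, unitExp_nat_mul]
  have h2 := geom_sum_mul (unitExp θ) n
  have h3 := congrArg norm h2
  rw [norm_mul] at h3
  have h4 : ‖unitExp θ ^ n - 1‖ ≤ 2 := by
    refine (norm_sub_le _ _).trans ?_
    rw [norm_pow, norm_unitExp]
    norm_num
  have h5 : 4 * η ≤ ‖unitExp θ - 1‖ := by linarith [four_mul_abs_sub_round_le θ]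
  rw [h1, norm_mul, norm_unitExp, mul_one, le_div_iff₀ (by positivity)]
  nlinarith [norm_nonneg (∑ l ∈ range n, unitExp θ ^ l)]

open Finset in
theorem normSq_sum_range_eq (u : ℕ → ℂ) (hu : ∀ l, ‖u l‖ = 1) (n : ℕ) :
    ‖∑ l ∈ range n, u l‖ ^ 2 = n + 2 * (∑ j ∈ range n, ∑ l ∈ range (n - 1 - j),
      u (l + (j + 1)) * (starRingEnd ℂ) (u l)).re := by
  induction n with
  | zero => simp
  | succ n ih =>
    have h1 : ∑ j ∈ range (n + 1), ∑ l ∈ range (n + 1 - 1 - j),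
        u (l + (j + 1)) * (starRingEnd ℂ) (u l) =
        (∑ j ∈ range n, ∑ l ∈ range (n - 1 - j), u (l + (j + 1)) * (starRingEnd ℂ) (u l)) +
          u n * (starRingEnd ℂ) (∑ l ∈ range n, u l) := by
      rw [sum_range_succ, Nat.add_sub_cancel, Nat.sub_self, range_zero, sum_empty, add_zero,
        map_sum, mul_sum, ← sum_range_reflect (fun j => u n * (starRingEnd ℂ) (u j)),
        ← sum_add_distrib]
      refine sum_congr rfl fun j hj => ?_
      have hj := mem_range.1 hj
      rw [show n - j = n - 1 - j + 1 by omega, sum_range_succ,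
        show n - 1 - j + (j + 1) = n by omega]
    have h2 : ‖∑ l ∈ range n, u l + u n‖ ^ 2 = ‖∑ l ∈ range n, u l‖ ^ 2 + 1 +
        2 * (u n * (starRingEnd ℂ) (∑ l ∈ range n, u l)).re := by
      have h3 : Complex.normSq (u n) = 1 := by rw [Complex.normSq_eq_norm_sq, hu, one_pow]
      rw [add_comm (∑ l ∈ range n, u l), ← Complex.normSq_eq_norm_sq, Complex.normSq_add, h3,
        Complex.normSq_eq_norm_sq]
      ring
    rw [sum_range_succ, h2, h1, ih, Complex.add_re]
    push_cast
    ring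

open Finset in
/-- The Weyl–van der Corput inequality. -/
theorem weyl_differencing (F : ℕ → ℝ) (n : ℕ) :
    ‖∑ l ∈ range n, unitExp (F l)‖ ^ 2 ≤ n + 2 * ∑ j ∈ range n,
      ‖∑ l ∈ range (n - 1 - j), unitExp (F (l + (j + 1)) - F l)‖ := by
  rw [normSq_sum_range_eq (fun l => unitExp (F l)) (fun l => norm_unitExp _)]
  gcongr
  refine (Complex.re_le_norm _).trans ((norm_sum_le _ _).trans (le_of_eq ?_))
  refine sum_congr rfl fun j _ => ?_
  congr 1
  refine sum_congr rfl fun l _ => ?_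
  rw [conj_unitExp, ← unitExp_add, sub_eq_add_neg]

open Finset in
/-- A version of the Kusmin–Landau inequality. -/
theorem kusmin_landau (ψ : ℕ → ℝ) (n : ℕ) {lam δ : ℝ} (hlam : 0 < lam) (hδ : 0 ≤ δ)
    (h1 : ∀ l < n, lam ≤ ψ (l + 1) - ψ l) (h2 : ∀ l < n, ψ (l + 1) - ψ l ≤ 1 / 2)
    (h3 : ∀ l, l + 1 < n → |(ψ (l + 2) - ψ (l + 1)) - (ψ (l + 1) - ψ l)| ≤ δ) :
    ‖∑ l ∈ range n, unitExp (ψ l)‖ ≤ 1 / (2 * lam) + n * (δ / (2 * lam ^ 2)) := by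
  set c : ℕ → ℂ := fun l => 1 / (1 - unitExp (ψ (l + 1) - ψ l)) with hc
  have hlow : ∀ l < n, 4 * lam ≤ ‖1 - unitExp (ψ (l + 1) - ψ l)‖ := by
    intro l hl
    have hg := h1 l hl
    have := four_mul_abs_le_norm_unitExp_sub_one (x := ψ (l + 1) - ψ l)
      (by rw [abs_of_nonneg (by linarith)]; exact h2 l hl)
    rw [abs_of_nonneg (by linarith)] at this
    rw [norm_sub_rev]
    linarith
  have hne : ∀ l < n, 1 - unitExp (ψ (l + 1) - ψ l) ≠ 0 := by
    intro l hl h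
    have := hlow l hl
    rw [h, norm_zero] at this
    linarith
  have hcn : ∀ l < n, ‖c l‖ ≤ 1 / (4 * lam) := by
    intro l hl
    rw [hc]
    simp only [norm_div, norm_one]
    exact one_div_le_one_div_of_le (by positivity) (hlow l hl)
  have hcu : ∀ l < n, unitExp (ψ l) + c l * unitExp (ψ (l + 1)) = c l * unitExp (ψ l) := by
    intro l hl
    have hu : unitExp (ψ (l + 1)) = unitExp (ψ l) * unitExp (ψ (l + 1) - ψ l) := by
      rw [← unitExp_add]; congr 1; ring
    have := hne l hl
    rw [hu, hc]
    field_simp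
    ring
  have hcd : ∀ l, l + 1 < n → ‖c (l + 1) - c l‖ ≤ δ / (2 * lam ^ 2) := by
    intro l hl
    have hd1 := hlow l (by omega)
    have hd2 := hlow (l + 1) hl
    have e1 := hne l (by omega)
    have e2 := hne (l + 1) hl
    have h4 : c (l + 1) - c l = (unitExp (ψ (l + 2) - ψ (l + 1)) - unitExp (ψ (l + 1) - ψ l)) /
        ((1 - unitExp (ψ (l + 2) - ψ (l + 1))) * (1 - unitExp (ψ (l + 1) - ψ l))) := by
      simp only [hc]
      rw [div_sub_div _ _ e2 e1]
      congr 1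
      ring_nf
    rw [h4, norm_div, norm_mul]
    have h5 := norm_unitExp_sub_unitExp_le (ψ (l + 2) - ψ (l + 1)) (ψ (l + 1) - ψ l)
    have h6 := h3 l hl
    have hpi := Real.pi_le_four
    calc _ ≤ (8 * δ) / ((4 * lam) * (4 * lam)) := by
          gcongr
          nlinarith [abs_nonneg ((ψ (l + 2) - ψ (l + 1)) - (ψ (l + 1) - ψ l)), Real.pi_pos]
      _ = δ / (2 * lam ^ 2) := by field_simp; ring
  have main : ∀ k, k < n → ‖∑ l ∈ range (k + 1), unitExp (ψ l) + c k * unitExp (ψ (k + 1))‖ ≤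
      1 / (4 * lam) + k * (δ / (2 * lam ^ 2)) := by
    intro k
    induction k with
    | zero =>
      intro h
      rw [zero_add, sum_range_one, hcu 0 h, norm_mul, norm_unitExp, mul_one]
      simpa using hcn 0 h
    | succ k ih =>
      intro h
      have h7 : ∑ l ∈ range (k + 1 + 1), unitExp (ψ l) + c (k + 1) * unitExp (ψ (k + 1 + 1)) =
          (∑ l ∈ range (k + 1), unitExp (ψ l) + c k * unitExp (ψ (k + 1))) +
          (c (k + 1) - c k) * unitExp (ψ (k + 1)) := by
        rw [sum_range_succ, add_assoc, hcu (k + 1) h]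
        ring
      rw [h7]
      refine (norm_add_le _ _).trans ?_
      rw [norm_mul, norm_unitExp, mul_one]
      push_cast
      linarith [ih (by omega), hcd k h]
  rcases n with _ | n
  · simp; positivity
  · have h8 := main n (by omega)
    have h9 : ‖∑ l ∈ range (n + 1), unitExp (ψ l)‖ ≤
        ‖∑ l ∈ range (n + 1), unitExp (ψ l) + c n * unitExp (ψ (n + 1))‖ +
          ‖c n * unitExp (ψ (n + 1))‖ := by
      have := norm_sub_le (∑ l ∈ range (n + 1), unitExp (ψ l) + c n * unitExp (ψ (n + 1)))
        (c n * unitExp (ψ (n + 1)))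
      rwa [add_sub_cancel_right] at this
    rw [norm_mul, norm_unitExp, mul_one] at h9
    have h10 := hcn n (by omega)
    have h11 : 1 / (4 * lam) + 1 / (4 * lam) = 1 / (2 * lam) := by field_simp; norm_num
    have h12 : 0 ≤ δ / (2 * lam ^ 2) := by positivity
    push_cast
    linarith

open Set in
theorem mul_le_shift_sub_and_le {f f1 : ℝ → ℝ} {X Y lo hi : ℝ}
    (hf : ∀ x ∈ Icc X Y, HasDerivAt f (f1 x) x) (hb : ∀ x ∈ Icc X Y, f1 x ∈ Icc lo hi)
    {a x : ℝ} (ha : 0 < a) (hx : X ≤ x) (hxa : x + a ≤ Y) :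
    f (x + a) - f x ∈ Icc (a * lo) (a * hi) := by
  obtain ⟨c, hc, h⟩ := exists_hasDerivAt_eq_slope f f1 (a := x) (b := x + a) (by linarith)
    (fun y hy => (hf y ⟨hx.trans hy.1, hy.2.trans hxa⟩).continuousAt.continuousWithinAt)
    (fun y hy => hf y ⟨hx.trans hy.1.le, hy.2.le.trans hxa⟩)
  have hcb := hb c ⟨hx.trans hc.1.le, hc.2.le.trans hxa⟩
  rw [add_sub_cancel_left, eq_div_iff ha.ne'] at h
  rw [← h, mul_comm (f1 c)]
  exact ⟨mul_le_mul_of_nonneg_left hcb.1 ha.le, mul_le_mul_of_nonneg_left hcb.2 ha.le⟩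

theorem HasDerivAt.shift_sub {f f1 : ℝ → ℝ} {x a : ℝ} (h1 : HasDerivAt f (f1 (x + a)) (x + a))
    (h2 : HasDerivAt f (f1 x) x) :
    HasDerivAt (fun y => f (y + a) - f y) (f1 (x + a) - f1 x) x :=
  (h1.comp_add_const x a).sub h2

open Set in
theorem shift_sub_two_mem {f f1 f2 : ℝ → ℝ} {X Y lo hi : ℝ}
    (hf : ∀ x ∈ Icc X Y, HasDerivAt f (f1 x) x) (hf1 : ∀ x ∈ Icc X Y, HasDerivAt f1 (f2 x) x)
    (hb : ∀ x ∈ Icc X Y, f2 x ∈ Icc lo hi)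
    {a b x : ℝ} (ha : 0 < a) (hb0 : 0 < b) (hx : X ≤ x) (hxa : x + a + b ≤ Y) :
    (f (x + a + b) - f (x + a)) - (f (x + b) - f x) ∈ Icc (a * (b * lo)) (a * (b * hi)) := by
  refine mul_le_shift_sub_and_le (f := fun y => f (y + b) - f y)
    (f1 := fun y => f1 (y + b) - f1 y) (X := X) (Y := Y - b) ?_ ?_ ha hx (by linarith)
  · intro y hy
    exact (hf _ ⟨by linarith [hy.1], by linarith [hy.2]⟩).shift_sub
      (hf _ ⟨hy.1, by linarith [hy.2]⟩)
  · intro y hy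
    exact mul_le_shift_sub_and_le hf1 hb hb0 hy.1 (by linarith [hy.2])

open Set in
theorem shift_sub_three_mem {f f1 f2 f3 : ℝ → ℝ} {X Y lo hi : ℝ}
    (hf : ∀ x ∈ Icc X Y, HasDerivAt f (f1 x) x) (hf1 : ∀ x ∈ Icc X Y, HasDerivAt f1 (f2 x) x)
    (hf2 : ∀ x ∈ Icc X Y, HasDerivAt f2 (f3 x) x)
    (hb : ∀ x ∈ Icc X Y, f3 x ∈ Icc lo hi)
    {a b c x : ℝ} (ha : 0 < a) (hb0 : 0 < b) (hc : 0 < c) (hx : X ≤ x)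
    (hxa : x + a + b + c ≤ Y) :
    ((f (x + a + b + c) - f (x + a + b)) - (f (x + a + c) - f (x + a))) -
      ((f (x + b + c) - f (x + b)) - (f (x + c) - f x)) ∈
      Icc (a * (b * (c * lo))) (a * (b * (c * hi))) := by
  refine shift_sub_two_mem (f := fun y => f (y + c) - f y) (f1 := fun y => f1 (y + c) - f1 y)
    (f2 := fun y => f2 (y + c) - f2 y) (X := X) (Y := Y - c) ?_ ?_ ?_ ha hb0 hx (by linarith)
  · intro y hy
    exact (hf _ ⟨by linarith [hy.1], by linarith [hy.2]⟩).shift_sub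
      (hf _ ⟨hy.1, by linarith [hy.2]⟩)
  · intro y hy
    exact (hf1 _ ⟨by linarith [hy.1], by linarith [hy.2]⟩).shift_sub
      (hf1 _ ⟨hy.1, by linarith [hy.2]⟩)
  · intro y hy
    exact mul_le_shift_sub_and_le hf2 hb hc hy.1 (by linarith [hy.2])

open Set in
theorem shift_sub_four_mem {f f1 f2 f3 f4 : ℝ → ℝ} {X Y lo hi : ℝ}
    (hf : ∀ x ∈ Icc X Y, HasDerivAt f (f1 x) x) (hf1 : ∀ x ∈ Icc X Y, HasDerivAt f1 (f2 x) x)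
    (hf2 : ∀ x ∈ Icc X Y, HasDerivAt f2 (f3 x) x) (hf3 : ∀ x ∈ Icc X Y, HasDerivAt f3 (f4 x) x)
    (hb : ∀ x ∈ Icc X Y, f4 x ∈ Icc lo hi)
    {a b c d x : ℝ} (ha : 0 < a) (hb0 : 0 < b) (hc : 0 < c) (hd : 0 < d) (hx : X ≤ x)
    (hxa : x + a + b + c + d ≤ Y) :
    (((f (x + a + b + c + d) - f (x + a + b + c)) - (f (x + a + b + d) - f (x + a + b))) -
      ((f (x + a + c + d) - f (x + a + c)) - (f (x + a + d) - f (x + a)))) -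
    (((f (x + b + c + d) - f (x + b + c)) - (f (x + b + d) - f (x + b))) -
      ((f (x + c + d) - f (x + c)) - (f (x + d) - f x))) ∈
      Icc (a * (b * (c * (d * lo)))) (a * (b * (c * (d * hi)))) := by
  refine shift_sub_three_mem (f := fun y => f (y + d) - f y) (f1 := fun y => f1 (y + d) - f1 y)
    (f2 := fun y => f2 (y + d) - f2 y) (f3 := fun y => f3 (y + d) - f3 y)
    (X := X) (Y := Y - d) ?_ ?_ ?_ ?_ ha hb0 hc hx (by linarith)
  · intro y hy
    exact (hf _ ⟨by linarith [hy.1], by linarith [hy.2]⟩).shift_sub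
      (hf _ ⟨hy.1, by linarith [hy.2]⟩)
  · intro y hy
    exact (hf1 _ ⟨by linarith [hy.1], by linarith [hy.2]⟩).shift_sub
      (hf1 _ ⟨hy.1, by linarith [hy.2]⟩)
  · intro y hy
    exact (hf2 _ ⟨by linarith [hy.1], by linarith [hy.2]⟩).shift_sub
      (hf2 _ ⟨hy.1, by linarith [hy.2]⟩)
  · intro y hy
    exact mul_le_shift_sub_and_le hf3 hb hd hy.1 (by linarith [hy.2])

section
open Set

variable {γ M : ℝ}

theorem hasDerivAt_const_mul_rpow {c s x : ℝ} (hx : 0 < x) :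
    HasDerivAt (fun y : ℝ => c * y ^ s) (c * s * x ^ (s - 1)) x := by
  have := (Real.hasDerivAt_rpow_const (p := s) (Or.inl hx.ne')).const_mul c
  rwa [← mul_assoc] at this

theorem rpow_third_derivative_mem (h0 : 0 < γ) (h1 : γ < 1) (hM : 0 < M) {x : ℝ}
    (hx : x ∈ Icc M (2 * M)) :
    1 * γ * (γ - 1) * (γ - 2) * x ^ (γ - 3) ∈
      Icc (γ * (1 - γ) * (2 - γ) * M ^ (γ - 3) / 8) (γ * (1 - γ) * (2 - γ) * M ^ (γ - 3)) := by
  have hc : 0 < γ * (1 - γ) * (2 - γ) :=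
    mul_pos (mul_pos h0 (by linarith)) (by linarith)
  have hx0 : 0 < x := hM.trans_le hx.1
  have e : 1 * γ * (γ - 1) * (γ - 2) * x ^ (γ - 3) = γ * (1 - γ) * (2 - γ) * x ^ (γ - 3) := by
    ring
  rw [e]
  constructor
  · rw [mul_div_assoc]
    refine mul_le_mul_of_nonneg_left ?_ hc.le
    calc M ^ (γ - 3) / 8 = M ^ (γ - 3) * (2 : ℝ) ^ (-3 : ℝ) := by
          rw [Real.rpow_neg (by norm_num)]; norm_num; ring
      _ ≤ M ^ (γ - 3) * (2 : ℝ) ^ (γ - 3) := by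
          gcongr
          · norm_num
          · linarith
      _ = (2 * M) ^ (γ - 3) := by rw [Real.mul_rpow (by norm_num) hM.le, mul_comm]
      _ ≤ x ^ (γ - 3) := Real.rpow_le_rpow_of_nonpos hx0 hx.2 (by linarith)
  · exact mul_le_mul_of_nonneg_left
      (Real.rpow_le_rpow_of_nonpos hM hx.1 (by linarith)) hc.le

theorem rpow_fourth_derivative_mem (h0 : 0 < γ) (h1 : γ < 1) (hM : 0 < M) {x : ℝ}
    (hx : x ∈ Icc M (2 * M)) :
    1 * γ * (γ - 1) * (γ - 2) * (γ - 3) * x ^ (γ - 4) ∈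
      Icc (-(3 * (γ * (1 - γ) * (2 - γ)) * M ^ (γ - 4))) 0 := by
  have hc : 0 < γ * (1 - γ) * (2 - γ) :=
    mul_pos (mul_pos h0 (by linarith)) (by linarith)
  have hx0 : 0 < x := hM.trans_le hx.1
  have hp : 0 < x ^ (γ - 4) := Real.rpow_pos_of_pos hx0 _
  have hle : x ^ (γ - 4) ≤ M ^ (γ - 4) := Real.rpow_le_rpow_of_nonpos hM hx.1 (by linarith)
  have e : 1 * γ * (γ - 1) * (γ - 2) * (γ - 3) * x ^ (γ - 4) =
    -((3 - γ) * (γ * (1 - γ) * (2 - γ)) * x ^ (γ - 4)) := by ring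
  rw [e]
  constructor
  · rw [neg_le_neg_iff]
    gcongr
    linarith
  · have : 0 ≤ (3 - γ) * (γ * (1 - γ) * (2 - γ)) * x ^ (γ - 4) :=
      mul_nonneg (mul_nonneg (by linarith) hc.le) hp.le
    linarith

theorem rpow_third_difference_mem (h0 : 0 < γ) (h1 : γ < 1) (hM : 0 < M) {a b c x : ℝ}
    (ha : 0 < a) (hb : 0 < b) (hc : 0 < c) (hx : M ≤ x) (hxa : x + a + b + c ≤ 2 * M) :
    (((x + a + b + c) ^ γ - (x + a + b) ^ γ) - ((x + a + c) ^ γ - (x + a) ^ γ)) -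
      (((x + b + c) ^ γ - (x + b) ^ γ) - ((x + c) ^ γ - x ^ γ)) ∈
      Icc (a * (b * (c * (γ * (1 - γ) * (2 - γ) * M ^ (γ - 3) / 8))))
        (a * (b * (c * (γ * (1 - γ) * (2 - γ) * M ^ (γ - 3))))) := by
  have := shift_sub_three_mem (f := fun y : ℝ => 1 * y ^ γ) (X := M) (Y := 2 * M)
    (fun y hy => hasDerivAt_const_mul_rpow (hM.trans_le hy.1))
    (fun y hy => hasDerivAt_const_mul_rpow (hM.trans_le hy.1))
    (fun y hy => hasDerivAt_const_mul_rpow (hM.trans_le hy.1))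
    (lo := γ * (1 - γ) * (2 - γ) * M ^ (γ - 3) / 8)
    (hi := γ * (1 - γ) * (2 - γ) * M ^ (γ - 3))
    (fun y hy => by
      have := rpow_third_derivative_mem h0 h1 hM hy
      rw [show γ - 1 - 1 = γ - 2 by ring, show γ - 2 - 1 = γ - 3 by ring]
      exact this) ha hb hc hx hxa
  simpa only [one_mul] using this

theorem rpow_fourth_difference_mem (h0 : 0 < γ) (h1 : γ < 1) (hM : 0 < M) {a b c d x : ℝ}
    (ha : 0 < a) (hb : 0 < b) (hc : 0 < c) (hd : 0 < d) (hx : M ≤ x)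
    (hxa : x + a + b + c + d ≤ 2 * M) :
    ((((x + a + b + c + d) ^ γ - (x + a + b + c) ^ γ) -
        ((x + a + b + d) ^ γ - (x + a + b) ^ γ)) -
      (((x + a + c + d) ^ γ - (x + a + c) ^ γ) - ((x + a + d) ^ γ - (x + a) ^ γ))) -
    ((((x + b + c + d) ^ γ - (x + b + c) ^ γ) - ((x + b + d) ^ γ - (x + b) ^ γ)) -
      (((x + c + d) ^ γ - (x + c) ^ γ) - ((x + d) ^ γ - x ^ γ))) ∈
      Icc (a * (b * (c * (d * -(3 * (γ * (1 - γ) * (2 - γ)) * M ^ (γ - 4))))))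
        (a * (b * (c * (d * 0)))) := by
  have := shift_sub_four_mem (f := fun y : ℝ => 1 * y ^ γ) (X := M) (Y := 2 * M)
    (fun y hy => hasDerivAt_const_mul_rpow (hM.trans_le hy.1))
    (fun y hy => hasDerivAt_const_mul_rpow (hM.trans_le hy.1))
    (fun y hy => hasDerivAt_const_mul_rpow (hM.trans_le hy.1))
    (fun y hy => hasDerivAt_const_mul_rpow (hM.trans_le hy.1))
    (lo := -(3 * (γ * (1 - γ) * (2 - γ)) * M ^ (γ - 4))) (hi := 0)
    (fun y hy => by
      have := rpow_fourth_derivative_mem h0 h1 hM hy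
      rw [show γ - 1 - 1 = γ - 2 by ring, show γ - 2 - 1 = γ - 3 by ring,
        show γ - 3 - 1 = γ - 4 by ring]
      exact this) ha hb hc hd hx hxa
  simpa only [one_mul] using this

end

open Finset in
/-- Exponential sums over a twice differenced phase `A x ^ γ`. -/
theorem norm_sum_second_difference_le {γ : ℝ} (h0 : 0 < γ) (h1 : γ < 1) {M n : ℕ} (hM : 1 ≤ M)
    (hn : n ≤ M) {A : ℝ} (hA : 1 ≤ A) (hAM : A ≤ (M : ℝ) ^ (1 - γ) / 2) (B b c : ℝ) (i j : ℕ) :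
    ‖∑ l ∈ range (n - 1 - j - 1 - i), unitExp
      (((A * ((M : ℝ) + ((l + (i + 1) + (j + 1) : ℕ) : ℝ)) ^ γ +
          B * ((l + (i + 1) + (j + 1) : ℕ) : ℝ) ^ 2 + b * ((l + (i + 1) + (j + 1) : ℕ) : ℝ) + c) -
        (A * ((M : ℝ) + ((l + (i + 1) : ℕ) : ℝ)) ^ γ +
          B * ((l + (i + 1) : ℕ) : ℝ) ^ 2 + b * ((l + (i + 1) : ℕ) : ℝ) + c)) -
      ((A * ((M : ℝ) + ((l + (j + 1) : ℕ) : ℝ)) ^ γ +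
          B * ((l + (j + 1) : ℕ) : ℝ) ^ 2 + b * ((l + (j + 1) : ℕ) : ℝ) + c) -
        (A * ((M : ℝ) + (l : ℝ)) ^ γ + B * (l : ℝ) ^ 2 + b * (l : ℝ) + c)))‖ ≤
    104 / (γ * (1 - γ) * (2 - γ)) * (M : ℝ) ^ (3 - γ) * (1 / ((i : ℝ) + 1)) *
      (1 / ((j : ℝ) + 1)) := by
  set k := γ * (1 - γ) * (2 - γ) with hk
  have hk0 : 0 < k := mul_pos (mul_pos h0 (by linarith)) (by linarith)
  have hk1 : k ≤ 1 := by
    have e1 : γ * (1 - γ) ≤ 1 / 4 := by nlinarith [sq_nonneg (γ - 1 / 2)]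
    nlinarith
  have hM0 : (0 : ℝ) < M := by exact_mod_cast hM
  set P := (M : ℝ) ^ (γ - 3) with hP
  have hP0 : 0 < P := Real.rpow_pos_of_pos hM0 _
  have hPi : (M : ℝ) ^ (3 - γ) = 1 / P := by
    rw [hP, one_div, ← Real.rpow_neg hM0.le, neg_sub]
  have hP4 : (M : ℝ) ^ (γ - 4) * M = P := by
    rw [hP, ← Real.rpow_add_one hM0.ne']
    congr 1; ring
  have hP1 : (M : ℝ) ^ (1 - γ) * (P * (M * M)) = 1 := by
    have : (M : ℝ) * M = (M : ℝ) ^ (2 : ℝ) := by norm_cast; ring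
    rw [this, hP, ← Real.rpow_add hM0, ← Real.rpow_add hM0]
    ring_nf
    exact Real.rpow_zero _
  rcases Nat.eq_zero_or_pos (n - 1 - j - 1 - i) with hz | hz
  · rw [hz, range_zero, sum_empty, norm_zero, hPi]
    positivity
  have hij : i + j + 2 < n := by omega
  set I : ℝ := (i : ℝ) + 1 with hI
  set J : ℝ := (j : ℝ) + 1 with hJ
  have hI0 : 0 < I := by positivity
  have hJ0 : 0 < J := by positivity
  have hIM : I ≤ M := by rw [hI]; norm_cast; omega
  have hJM : J ≤ M := by rw [hJ]; norm_cast; omega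
  have hnM : (((n - 1 - j - 1 - i : ℕ)) : ℝ) ≤ M := by norm_cast; omega
  set lam := A * (I * (J * (k * P))) / 8 with hlam
  set δ := A * (I * (J * (3 * k * (M : ℝ) ^ (γ - 4)))) with hδ
  have hlam0 : 0 < lam := by positivity
  have hδ0 : 0 ≤ δ := by positivity
  have hpt : ∀ l : ℕ, l < n - 1 - j - 1 - i → (M : ℝ) + l + 1 + I + J ≤ 2 * M := by
    intro l hl
    have : ((l + i + j + 3 : ℕ) : ℝ) ≤ M := by norm_cast; omega
    push_cast at this
    rw [hI, hJ]
    linarith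
  refine (kusmin_landau _ _ hlam0 hδ0 ?_ ?_ ?_).trans ?_
  · intro l hl
    have := (rpow_third_difference_mem h0 h1 hM0 one_pos hI0 hJ0
      (by linarith [(Nat.cast_nonneg l : (0 : ℝ) ≤ l)] : (M : ℝ) ≤ M + l) (hpt l hl)).1
    have h2 := mul_le_mul_of_nonneg_left this (by linarith : 0 ≤ A)
    push_cast
    rw [hlam]
    simp only [← hI, ← hJ, ← hk, ← hP] at h2 ⊢
    ring_nf at h2 ⊢
    linarith
  · intro l hl
    have := (rpow_third_difference_mem h0 h1 hM0 one_pos hI0 hJ0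
      (by linarith [(Nat.cast_nonneg l : (0 : ℝ) ≤ l)] : (M : ℝ) ≤ M + l) (hpt l hl)).2
    have h2 := mul_le_mul_of_nonneg_left this (by linarith : 0 ≤ A)
    have h3 : A * (1 * (I * (J * (k * P)))) ≤ 1 / 2 := by
      calc A * (1 * (I * (J * (k * P)))) ≤ (M : ℝ) ^ (1 - γ) / 2 * (1 * (M * (M * (1 * P)))) := by
            gcongr
        _ = 1 / 2 := by linear_combination (1 / 2) * hP1
    push_cast
    simp only [← hI, ← hJ, ← hk, ← hP] at h2 h3 ⊢
    ring_nf at h2 h3 ⊢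
    linarith
  · intro l hl
    have := rpow_fourth_difference_mem h0 h1 hM0 one_pos one_pos hI0 hJ0
      (by linarith [(Nat.cast_nonneg l : (0 : ℝ) ≤ l)] : (M : ℝ) ≤ M + l)
      (by have := hpt (l + 1) hl; push_cast at this; linarith)
    have hA0 : 0 ≤ A := by linarith
    have h2 := mul_le_mul_of_nonneg_left this.1 hA0
    have h3 := mul_le_mul_of_nonneg_left this.2 hA0
    rw [abs_le]
    push_cast
    rw [hδ]
    simp only [← hI, ← hJ, ← hk] at h2 h3 ⊢
    constructor
    · ring_nf at h2 ⊢
      linarith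
    · have : 0 ≤ A * (I * (J * (3 * k * (M : ℝ) ^ (γ - 4)))) := hδ0
      ring_nf at this h3 ⊢
      linarith
  · have h4 : M * δ = 24 * lam := by
      rw [hδ, hlam, ← hP4]; ring
    calc 1 / (2 * lam) + ((n - 1 - j - 1 - i : ℕ) : ℝ) * (δ / (2 * lam ^ 2))
        ≤ 1 / (2 * lam) + M * (δ / (2 * lam ^ 2)) := by gcongr
      _ = 1 / (2 * lam) + (M * δ) / (2 * lam ^ 2) := by ring
      _ ≤ 13 / lam := by
          rw [h4]
          apply le_of_sub_nonneg
          field_simp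
          norm_num
      _ = 104 / (A * (I * (J * (k * P)))) := by rw [hlam]; field_simp; norm_num
      _ ≤ 104 / (1 * (I * (J * (k * P)))) := by gcongr
      _ = 104 / k * (M : ℝ) ^ (3 - γ) * (1 / I) * (1 / J) := by
          rw [hPi]; field_simp

open Finset in
theorem sum_one_div_succ_le {n M : ℕ} (hn : n ≤ M) :
    ∑ i ∈ range n, 1 / ((i : ℝ) + 1) ≤ 1 + Real.log M := by
  have h := harmonic_le_one_add_log M
  rw [harmonic] at h
  push_cast at h
  refine le_trans ?_ h
  simp only [one_div]
  exact sum_le_sum_of_subset_of_nonneg (range_subset_range.2 hn) fun _ _ _ => by positivity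

open Finset in
/-- Exponential sums whose phase is `A x ^ γ` plus an arbitrary quadratic polynomial. -/
theorem norm_sum_rpow_add_quadratic_le {γ : ℝ} (h0 : 0 < γ) (h1 : γ < 1) {M n : ℕ} (hM : 1 ≤ M)
    (hn : n ≤ M) {A : ℝ} (hA : 1 ≤ A) (hAM : A ≤ (M : ℝ) ^ (1 - γ) / 2) (B b c : ℝ) :
    ‖∑ l ∈ range n, unitExp (A * ((M : ℝ) + (l : ℝ)) ^ γ + B * (l : ℝ) ^ 2 + b * (l : ℝ) + c)‖ ^ 4
      ≤ (10 + 16 * (104 / (γ * (1 - γ) * (2 - γ)))) *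
        ((M : ℝ) ^ (4 - γ) * (1 + Real.log M) ^ 2) := by
  set F : ℕ → ℝ := fun l => A * ((M : ℝ) + (l : ℝ)) ^ γ + B * (l : ℝ) ^ 2 + b * (l : ℝ) + c
    with hF
  set k := γ * (1 - γ) * (2 - γ) with hk
  have hk0 : 0 < k := mul_pos (mul_pos h0 (by linarith)) (by linarith)
  have hM1 : (1 : ℝ) ≤ M := by exact_mod_cast hM
  have hM0 : (0 : ℝ) < M := by linarith
  have hnM : (n : ℝ) ≤ M := by exact_mod_cast hn
  set L := 1 + Real.log M with hL
  have hL1 : 1 ≤ L := by linarith [Real.log_nonneg hM1]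
  set Q := (M : ℝ) ^ (3 - γ) with hQ
  have hQ0 : 0 < Q := Real.rpow_pos_of_pos hM0 _
  have hQ4 : (M : ℝ) ^ (4 - γ) = Q * M := by
    rw [hQ, ← Real.rpow_add_one hM0.ne']; congr 1; ring
  have hQM : (M : ℝ) ^ 2 ≤ Q := by
    rw [hQ, ← Real.rpow_natCast]
    exact Real.rpow_le_rpow_of_exponent_le hM1 (by push_cast; linarith)
  have hH := sum_one_div_succ_le hn
  set S : ℕ → ℝ := fun j => ‖∑ l ∈ range (n - 1 - j), unitExp (F (l + (j + 1)) - F l)‖ with hS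
  have hSj : ∀ j, S j ^ 2 ≤ M + 2 * (104 / k) * Q * L * (1 / ((j : ℝ) + 1)) := by
    intro j
    refine (weyl_differencing (fun l => F (l + (j + 1)) - F l) (n - 1 - j)).trans ?_
    have e1 : ((n - 1 - j : ℕ) : ℝ) ≤ M := by norm_cast; omega
    have e2 : ∑ i ∈ range (n - 1 - j), ‖∑ l ∈ range (n - 1 - j - 1 - i),
        unitExp (F (l + (i + 1) + (j + 1)) - F (l + (i + 1)) - (F (l + (j + 1)) - F l))‖ ≤
        ∑ i ∈ range n, 104 / k * Q * (1 / ((i : ℝ) + 1)) * (1 / ((j : ℝ) + 1)) := by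
      refine (sum_le_sum fun i _ =>
        norm_sum_second_difference_le h0 h1 hM hn hA hAM B b c i j).trans ?_
      exact sum_le_sum_of_subset_of_nonneg (range_subset_range.2 (by omega))
        fun _ _ _ => by positivity
    rw [← sum_mul, ← mul_sum] at e2
    have e3 : 104 / k * Q * (∑ i ∈ range n, 1 / ((i : ℝ) + 1)) * (1 / ((j : ℝ) + 1)) ≤
        104 / k * Q * L * (1 / ((j : ℝ) + 1)) := by gcongr
    linarith
  have hsum : ∑ j ∈ range n, S j ^ 2 ≤ M ^ 2 + 2 * (104 / k) * Q * L ^ 2 := by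
    refine (sum_le_sum fun j _ => hSj j).trans ?_
    rw [sum_add_distrib, ← mul_sum, sum_const, card_range, nsmul_eq_mul]
    have : 2 * (104 / k) * Q * L * (∑ i ∈ range n, 1 / ((i : ℝ) + 1)) ≤
        2 * (104 / k) * Q * L * L := by gcongr
    nlinarith
  have hcs : (∑ j ∈ range n, S j) ^ 2 ≤ M * ∑ j ∈ range n, S j ^ 2 := by
    have := sq_sum_le_card_mul_sum_sq (s := range n) (f := S)
    rw [card_range] at this
    refine this.trans ?_
    gcongr
  have hW : ‖∑ l ∈ range n, unitExp (F l)‖ ^ 2 ≤ M + 2 * ∑ j ∈ range n, S j := by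
    refine (weyl_differencing F n).trans ?_
    linarith
  have hT0 : 0 ≤ ∑ j ∈ range n, S j := sum_nonneg fun _ _ => norm_nonneg _
  set T := ∑ j ∈ range n, S j
  set W := ‖∑ l ∈ range n, unitExp (F l)‖
  have hL2 : 1 ≤ L ^ 2 := one_le_pow₀ hL1
  calc W ^ 4 = (W ^ 2) ^ 2 := by ring
    _ ≤ (M + 2 * T) ^ 2 := by gcongr
    _ ≤ 2 * M ^ 2 + 8 * T ^ 2 := by nlinarith [sq_nonneg ((M : ℝ) - 2 * T)]
    _ ≤ 2 * M ^ 2 + 8 * (M * (M ^ 2 + 2 * (104 / k) * Q * L ^ 2)) := by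
        have := mul_le_mul_of_nonneg_left hsum hM0.le
        linarith
    _ = 2 * M ^ 2 + 8 * (M ^ 2 * M) + 16 * (104 / k) * (Q * M * L ^ 2) := by ring
    _ ≤ 2 * (Q * M * L ^ 2) + 8 * (Q * M * L ^ 2) + 16 * (104 / k) * (Q * M * L ^ 2) := by
        have e1 : (M : ℝ) ^ 2 * M * 1 ≤ Q * M * L ^ 2 := by gcongr
        have e2 : (M : ℝ) ^ 2 * 1 ≤ M ^ 2 * M := by gcongr
        linarith
    _ = _ := by rw [hQ4]; ring

/-- Multiples of a real number with a good rational approximation are well spaced. -/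
theorem one_div_le_abs_mul_sub_int {α : ℝ} {a : ℤ} {q : ℕ} (hq : 0 < q)
    (hgcd : Int.gcd a (q : ℤ) = 1) (hα : |α - (a : ℝ) / (q : ℝ)| < 1 / (q : ℝ) ^ 2)
    {t : ℤ} (ht : t ≠ 0) (htq : 2 * |t| ≤ q) (m : ℤ) : 1 / (2 * (q : ℝ)) ≤ |t * α - m| := by
  have hq0 : (0 : ℝ) < q := by exact_mod_cast hq
  have hne : t * a - m * q ≠ 0 := by
    intro h
    have hdvd : (q : ℤ) ∣ t * a := ⟨m, by linarith⟩
    have hcop : IsCoprime (q : ℤ) a := (Int.isCoprime_iff_gcd_eq_one.2 hgcd).symm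
    have h2 := Int.le_of_dvd (abs_pos.2 ht) ((dvd_abs _ _).2 (hcop.dvd_of_dvd_mul_right hdvd))
    have : (0 : ℤ) < q := by exact_mod_cast hq
    linarith
  have h1 : (1 : ℝ) ≤ |(t : ℝ) * a - m * q| := by
    exact_mod_cast Int.one_le_abs hne
  have h2 : (1 : ℝ) / q ≤ |(t : ℝ) * (a / q) - m| := by
    have : (t : ℝ) * (a / q) - m = (t * a - m * q) / q := by field_simp
    rw [this, abs_div, abs_of_pos hq0]
    gcongr
  have h3 : |(t : ℝ) * (α - a / q)| ≤ 1 / (2 * q) := by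
    rw [abs_mul]
    have htq' : 2 * |(t : ℝ)| ≤ q := by exact_mod_cast htq
    calc |(t : ℝ)| * |α - a / q| ≤ (q / 2) * (1 / (q : ℝ) ^ 2) := by
          gcongr
          linarith
      _ = 1 / (2 * q) := by field_simp
  have h4 : |(t : ℝ) * (a / q) - m| ≤ |t * α - m| + |(t : ℝ) * (α - a / q)| := by
    have : (t : ℝ) * (a / q) - m = (t * α - m) - t * (α - a / q) := by ring
    rw [this]
    exact abs_sub _ _
  have h5 : (1 : ℝ) / q = 1 / (2 * q) + 1 / (2 * q) := by field_simp; norm_num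
  linarith

open Finset in
theorem card_close_multiples_le {α : ℝ} {a : ℤ} {q : ℕ} (hq : 0 < q)
    (hgcd : Int.gcd a (q : ℤ) = 1) (hα : |α - (a : ℝ) / (q : ℝ)| < 1 / (q : ℝ) ^ 2)
    {k : ℤ} (hk : k ≠ 0) (v : ℕ) (hb : 2 * |k| * v ≤ q) (hv : 0 < v) (n : ℕ) {η : ℝ} (hη : 0 ≤ η) :
    (#((range n).filter fun j : ℕ =>
      |k * α * ((j : ℝ) + 1) - round (k * α * ((j : ℝ) + 1))| < η) : ℝ) ≤
      ((n : ℝ) / v + 1) * (4 * η * q + 3) := by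
  have hq0 : (0 : ℝ) < q := by exact_mod_cast hq
  set u : ℕ → ℝ := fun j => k * α * ((j : ℝ) + 1) - round (k * α * ((j : ℝ) + 1)) with hu
  set R : ℤ := ⌊2 * η * q⌋ with hR
  have hR0 : 0 ≤ R := Int.floor_nonneg.2 (by positivity)
  set T := range (n / v + 1) ×ˢ Icc (-(R + 1)) R with hT
  have hcard : #{j ∈ range n | |u j| < η} ≤ #T := by
    refine card_le_card_of_injOn (fun j => (j / v, ⌊u j * (2 * q)⌋)) ?_ ?_
    · intro j hj
      simp only [coe_filter, mem_range, Set.mem_ofPred_eq] at hj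
      obtain ⟨h1, h2⟩ := abs_lt.1 hj.2
      simp only [hT, coe_product, Set.mem_prod, mem_coe, mem_range, mem_Icc]
      refine ⟨Nat.lt_succ_of_le (Nat.div_le_div_right hj.1.le), ?_, ?_⟩
      · rw [Int.le_floor]
        push_cast
        have := Int.lt_floor_add_one (2 * η * q)
        rw [← hR] at this
        nlinarith
      · rw [hR]
        exact Int.floor_le_floor (by nlinarith)
    · intro i hi j hj h
      simp only [Prod.mk.injEq] at h
      obtain ⟨h1, h2⟩ := h
      by_contra hne
      have h3 := Int.abs_sub_lt_one_of_floor_eq_floor h2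
      rw [← sub_mul, abs_mul, abs_of_pos (by positivity : (0 : ℝ) < 2 * q)] at h3
      have hij : |(i : ℤ) - j| < v := by
        have e1 := Nat.div_add_mod i v
        have e2 := Nat.div_add_mod j v
        have e3 := Nat.mod_lt i hv
        have e4 := Nat.mod_lt j hv
        rw [h1] at e1
        rw [abs_lt]
        constructor <;> omega
      have ht : k * ((i : ℤ) - j) ≠ 0 :=
        mul_ne_zero hk (sub_ne_zero.2 (by exact_mod_cast hne))
      have htq : 2 * |k * ((i : ℤ) - j)| ≤ q := by
        rw [abs_mul]
        nlinarith [abs_nonneg k]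
      have h4 := one_div_le_abs_mul_sub_int hq hgcd hα ht htq
        (round (k * α * ((i : ℝ) + 1)) - round (k * α * ((j : ℝ) + 1)))
      have h5 : u i - u j = ((k * ((i : ℤ) - j) : ℤ) : ℝ) * α -
          ((round (k * α * ((i : ℝ) + 1)) - round (k * α * ((j : ℝ) + 1)) : ℤ) : ℝ) := by
        simp only [hu]
        push_cast
        ring
      rw [← h5, div_le_iff₀ (by positivity)] at h4
      linarith
  have hTc : (#T : ℝ) = ((n / v : ℕ) + 1) * (2 * R + 2) := by
    rw [hT, card_product, card_range, Int.card_Icc]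
    have : ((R + 1 - -(R + 1)).toNat : ℤ) = 2 * R + 2 := by
      rw [Int.toNat_of_nonneg (by linarith)]; ring
    have h' : ((R + 1 - -(R + 1)).toNat : ℝ) = 2 * R + 2 := by exact_mod_cast this
    push_cast
    rw [h']
  calc _ ≤ (#T : ℝ) := Nat.cast_le.2 hcard
    _ ≤ _ := by
      rw [hTc]
      have e1 : ((n / v : ℕ) : ℝ) ≤ n / v := Nat.cast_div_le
      have e2 : (R : ℝ) ≤ 2 * η * q := Int.floor_le _
      have e3 : (0 : ℝ) ≤ R := by exact_mod_cast hR0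
      refine mul_le_mul (by linarith) (by linarith) (by linarith) (by positivity)

open Finset in
/-- Quadratic Weyl sums. -/
theorem norm_sum_quadratic_sq_le {α : ℝ} {a : ℤ} {q : ℕ} (hq : 0 < q)
    (hgcd : Int.gcd a (q : ℤ) = 1) (hα : |α - (a : ℝ) / (q : ℝ)| < 1 / (q : ℝ) ^ 2)
    {k : ℤ} (hk : k ≠ 0) (v : ℕ) (hb : 4 * |k| * v ≤ q) (hv : 0 < v) (n : ℕ) {η : ℝ}
    (hη : 0 < η) (b c : ℝ) :
    ‖∑ l ∈ range n, unitExp (k * α * (l : ℝ) ^ 2 + b * l + c)‖ ^ 2 ≤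
      n + 2 * (n * (((n : ℝ) / v + 1) * (4 * η * q + 3)) + n * (1 / (2 * η))) := by
  set F : ℕ → ℝ := fun l => k * α * (l : ℝ) ^ 2 + b * l + c with hF
  refine (weyl_differencing F n).trans ?_
  gcongr
  set C : Finset ℕ := {j ∈ range n | |((2 * k : ℤ) : ℝ) * α * ((j : ℝ) + 1) -
    round (((2 * k : ℤ) : ℝ) * α * ((j : ℝ) + 1))| < η} with hC
  have hCc : (#C : ℝ) ≤ ((n : ℝ) / v + 1) * (4 * η * q + 3) := by
    refine card_close_multiples_le hq hgcd hα (mul_ne_zero two_ne_zero hk) v ?_ hv n hη.le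
    rw [abs_mul, abs_two]
    linarith
  calc ∑ j ∈ range n, ‖∑ l ∈ range (n - 1 - j), unitExp (F (l + (j + 1)) - F l)‖
      ≤ ∑ j ∈ range n, ((if j ∈ C then (n : ℝ) else 0) + 1 / (2 * η)) := by
        refine sum_le_sum fun j hj => ?_
        split_ifs with h
        · have h1 := norm_sum_unitExp_le (range (n - 1 - j)) (fun l => F (l + (j + 1)) - F l)
          rw [card_range] at h1
          have h2 : ((n - 1 - j : ℕ) : ℝ) ≤ n := by norm_cast; omega
          have h3 : 0 ≤ 1 / (2 * η) := by positivity
          linarith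
        · rw [zero_add]
          have h1 : ∀ l : ℕ, F (l + (j + 1)) - F l =
              (((2 * k : ℤ) : ℝ) * α * ((j : ℝ) + 1)) * l +
                (k * α * ((j : ℝ) + 1) ^ 2 + b * ((j : ℝ) + 1)) := by
            intro l
            simp only [hF]
            push_cast
            ring
          simp only [h1]
          refine norm_sum_unitExp_linear_le _ _ _ hη ?_
          rw [hC, mem_filter, not_and] at h
          exact not_lt.1 (h hj)
    _ = #C * n + n * (1 / (2 * η)) := by
        rw [sum_add_distrib, ← sum_filter, sum_const, sum_const, card_range, nsmul_eq_mul,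
          nsmul_eq_mul]
        congr 4
        ext j
        rw [mem_filter]
        exact ⟨fun h => h.2, fun h => ⟨(mem_filter.1 h).1, h⟩⟩
    _ ≤ n * (((n : ℝ) / v + 1) * (4 * η * q + 3)) + n * (1 / (2 * η)) := by
        rw [mul_comm (#C : ℝ)]
        gcongr

open Filter in
theorem eventually_mul_log_pow_le_rpow (C : ℝ) (k : ℕ) {a b : ℝ} (hab : a < b) :
    ∀ᶠ x : ℝ in atTop, C * (x ^ a * (1 + Real.log x) ^ k) ≤ x ^ b := by
  have h1 := (isLittleO_log_rpow_rpow_atTop (k : ℝ) (sub_pos.2 hab)).bound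
    (c := 1 / ((|C| + 1) * 2 ^ k)) (by positivity)
  filter_upwards [h1, eventually_ge_atTop (Real.exp 1)] with x hx hxe
  have hx0 : 0 < x := (Real.exp_pos 1).trans_le hxe
  have hl : 1 ≤ Real.log x := by
    rw [← Real.log_exp 1]
    exact Real.log_le_log (Real.exp_pos 1) hxe
  rw [Real.rpow_natCast, Real.norm_of_nonneg (by positivity),
    Real.norm_of_nonneg (by positivity), div_mul_eq_mul_div, one_mul,
    le_div_iff₀ (by positivity)] at hx
  calc C * (x ^ a * (1 + Real.log x) ^ k) ≤ (|C| + 1) * (x ^ a * (2 * Real.log x) ^ k) := by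
        gcongr
        · linarith [le_abs_self C]
        · linarith
    _ = x ^ a * (Real.log x ^ k * ((|C| + 1) * 2 ^ k)) := by rw [mul_pow]; ring
    _ ≤ x ^ a * x ^ (b - a) := by gcongr
    _ = x ^ b := by rw [← Real.rpow_add hx0]; congr 1; ring

open Finset in
theorem norm_sum_unitExp_neg (F : ℕ → ℝ) (s : Finset ℕ) :
    ‖∑ l ∈ s, unitExp (-F l)‖ = ‖∑ l ∈ s, unitExp (F l)‖ := by
  rw [← Complex.norm_conj (∑ l ∈ s, unitExp (F l)), map_sum]
  simp only [conj_unitExp]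

open Filter Finset in
theorem eventually_norm_sum_rpow_add_quadratic_le {γ : ℝ} (h0 : 13 / 14 < γ) (h1 : γ < 1) :
    ∀ᶠ M : ℕ in atTop, ∀ n ≤ M, ∀ A : ℝ, 1 ≤ A → A ≤ (M : ℝ) ^ (1 - γ) / 2 → ∀ B b c : ℝ,
      ‖∑ l ∈ range n, unitExp (A * ((M : ℝ) + (l : ℝ)) ^ γ + B * (l : ℝ) ^ 2 + b * (l : ℝ) + c)‖
        ≤ (M : ℝ) ^ (5 / 6 : ℝ) := by
  have h2 := (eventually_mul_log_pow_le_rpow (10 + 16 * (104 / (γ * (1 - γ) * (2 - γ)))) 2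
    (show 4 - γ < 10 / 3 by linarith)).natCast_atTop
  filter_upwards [h2, eventually_ge_atTop 1] with M hM hM1 n hn A hA hAM B b c
  have h3 := (norm_sum_rpow_add_quadratic_le (by linarith) h1 hM1 hn hA hAM B b c).trans hM
  have hM0 : (0 : ℝ) ≤ M := Nat.cast_nonneg _
  refine le_of_pow_le_pow_left₀ (n := 4) (by norm_num) (by positivity) (h3.trans (le_of_eq ?_))
  rw [← Real.rpow_natCast, ← Real.rpow_mul hM0]
  norm_num

/-- `q` lies in the range of denominators useful for sums of length `M`, and `a / q` is a good
reduced approximation to `α`. -/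
def GoodApprox (α : ℝ) (a : ℤ) (q M : ℕ) : Prop :=
  Int.gcd a (q : ℤ) = 1 ∧ |α - (a : ℝ) / (q : ℝ)| < 1 / (q : ℝ) ^ 2 ∧
    (M : ℝ) ^ (9 / 10 : ℝ) ≤ q ∧ (q : ℝ) ≤ (M : ℝ) ^ (9 / 8 : ℝ)

open Filter Finset in
theorem eventually_norm_sum_quadratic_le :
    ∀ᶠ M : ℕ in atTop, ∀ n ≤ M, ∀ (α : ℝ) (a : ℤ) (q : ℕ), GoodApprox α a q M →
      ∀ k : ℤ, k ≠ 0 → |(k : ℝ)| ≤ (M : ℝ) ^ (1 / 25 : ℝ) → ∀ b c : ℝ,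
      ‖∑ l ∈ range n, unitExp (k * α * (l : ℝ) ^ 2 + b * (l : ℝ) + c)‖
        ≤ (M : ℝ) ^ (5 / 6 : ℝ) := by
  have h1 := (eventually_mul_log_pow_le_rpow 4 0
    (show (1 / 25 : ℝ) < 9 / 10 by norm_num)).natCast_atTop
  have h2 := (eventually_mul_log_pow_le_rpow 128 0
    (show (327 / 200 : ℝ) < 5 / 3 by norm_num)).natCast_atTop
  filter_upwards [h1, h2, eventually_ge_atTop 1] with M hM hM' hM1 n hn α a q hq k hk hkM b c
  obtain ⟨hgcd, hα, hq1, hq2⟩ := hq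
  rw [pow_zero, mul_one] at hM hM'
  have hM1' : (1 : ℝ) ≤ M := by exact_mod_cast hM1
  have hM0 : (0 : ℝ) < M := by linarith
  have hnM : (n : ℝ) ≤ M := by exact_mod_cast hn
  have hq0 : (0 : ℝ) < q := lt_of_lt_of_le (by positivity) hq1
  have hqn : 0 < q := by exact_mod_cast hq0
  have hk1 : 1 ≤ k.natAbs := Int.natAbs_pos.2 hk
  have hkr : |(k : ℝ)| = (k.natAbs : ℝ) := by rw [Nat.cast_natAbs]; push_cast; rfl
  rw [hkr] at hkM
  have hk1' : (1 : ℝ) ≤ k.natAbs := by exact_mod_cast hk1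
  set v := q / (4 * k.natAbs) with hv
  have h4k : 4 * k.natAbs ≤ q := by
    have : (4 : ℝ) * k.natAbs ≤ q := by linarith
    exact_mod_cast this
  have hv0 : 0 < v := Nat.div_pos h4k (by omega)
  have hvb : 4 * |k| * v ≤ q := by
    have : 4 * k.natAbs * v ≤ q := Nat.mul_div_le _ _
    rw [Int.abs_eq_natAbs]
    exact_mod_cast this
  have hvl : (q : ℝ) ≤ 8 * k.natAbs * v := by
    have e1 : q < 4 * k.natAbs * (v + 1) := by
      rw [hv]
      exact Nat.lt_mul_div_succ q (by omega)
    have : q ≤ 8 * k.natAbs * v := by nlinarith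
    exact_mod_cast this
  have hv0' : (0 : ℝ) < v := by exact_mod_cast hv0
  set η : ℝ := (M : ℝ) ^ (-(63 / 100) : ℝ) with hη
  have hη0 : 0 < η := by positivity
  have key := norm_sum_quadratic_sq_le hqn hgcd hα hk v hvb hv0 n hη0 b c
  have e1 : (n : ℝ) / v + 1 ≤ 9 * (M : ℝ) ^ (7 / 50 : ℝ) := by
    have : (n : ℝ) / v ≤ 8 * (M : ℝ) ^ (7 / 50 : ℝ) := by
      rw [div_le_iff₀ hv0']
      calc (n : ℝ) ≤ M := hnM
        _ = (M : ℝ) ^ (9 / 10 : ℝ) * (M : ℝ) ^ (1 / 10 : ℝ) := by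
            rw [← Real.rpow_add hM0]; norm_num
        _ ≤ (8 * k.natAbs * v) * (M : ℝ) ^ (1 / 10 : ℝ) := by
            gcongr; linarith
        _ ≤ (8 * (M : ℝ) ^ (1 / 25 : ℝ) * v) * (M : ℝ) ^ (1 / 10 : ℝ) := by gcongr
        _ = 8 * ((M : ℝ) ^ (1 / 25 : ℝ) * (M : ℝ) ^ (1 / 10 : ℝ)) * v := by ring
        _ = 8 * (M : ℝ) ^ (7 / 50 : ℝ) * v := by rw [← Real.rpow_add hM0]; norm_num
    have := Real.one_le_rpow hM1' (show (0 : ℝ) ≤ 7 / 50 by norm_num)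
    linarith
  have e2 : 4 * η * q + 3 ≤ 7 * (M : ℝ) ^ (99 / 200 : ℝ) := by
    have : η * q ≤ (M : ℝ) ^ (99 / 200 : ℝ) := by
      calc η * q ≤ η * (M : ℝ) ^ (9 / 8 : ℝ) := by gcongr
        _ = (M : ℝ) ^ (99 / 200 : ℝ) := by rw [hη, ← Real.rpow_add hM0]; norm_num
    have := Real.one_le_rpow hM1' (show (0 : ℝ) ≤ 99 / 200 by norm_num)
    linarith
  have e3 : 1 / (2 * η) ≤ (M : ℝ) ^ (127 / 200 : ℝ) / 2 := by
    have : 1 / (2 * η) = (M : ℝ) ^ (63 / 100 : ℝ) / 2 := by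
      rw [hη, Real.rpow_neg hM0.le]; field_simp
    rw [this]
    linarith [Real.rpow_le_rpow_of_exponent_le hM1' (show (63 / 100 : ℝ) ≤ 127 / 200 by norm_num)]
  have e4 : (M : ℝ) ≤ M * (M : ℝ) ^ (127 / 200 : ℝ) := by
    have := Real.one_le_rpow hM1' (show (0 : ℝ) ≤ 127 / 200 by norm_num)
    nlinarith
  have e5 : (M : ℝ) * (M : ℝ) ^ (127 / 200 : ℝ) = (M : ℝ) ^ (327 / 200 : ℝ) := by
    rw [mul_comm, ← Real.rpow_add_one hM0.ne']; norm_num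
  have e6 : (M : ℝ) ^ (7 / 50 : ℝ) * (M : ℝ) ^ (99 / 200 : ℝ) = (M : ℝ) ^ (127 / 200 : ℝ) := by
    rw [← Real.rpow_add hM0]; norm_num
  refine le_of_pow_le_pow_left₀ (n := 2) (by norm_num) (by positivity) ?_
  calc _ ≤ n + 2 * (n * (((n : ℝ) / v + 1) * (4 * η * q + 3)) + n * (1 / (2 * η))) := key
    _ ≤ M + 2 * (M * ((9 * (M : ℝ) ^ (7 / 50 : ℝ)) * (7 * (M : ℝ) ^ (99 / 200 : ℝ))) +
          M * ((M : ℝ) ^ (127 / 200 : ℝ) / 2)) := by gcongr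
    _ = M + 126 * (M * ((M : ℝ) ^ (7 / 50 : ℝ) * (M : ℝ) ^ (99 / 200 : ℝ))) +
          M * (M : ℝ) ^ (127 / 200 : ℝ) := by ring
    _ ≤ 128 * (M : ℝ) ^ (327 / 200 : ℝ) := by rw [e6, ← e5]; linarith
    _ ≤ (M : ℝ) ^ (5 / 3 : ℝ) := hM'
    _ = ((M : ℝ) ^ (5 / 6 : ℝ)) ^ 2 := by
        rw [← Real.rpow_natCast, ← Real.rpow_mul hM0.le]; norm_num

open Filter Finset in
theorem eventually_norm_sum_le {γ : ℝ} (h0 : 13 / 14 < γ) (h1 : γ < 1) :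
    ∀ᶠ M : ℕ in atTop, ∀ n ≤ M, ∀ (α : ℝ) (a : ℤ) (q : ℕ), GoodApprox α a q M →
      ∀ h k : ℤ, ¬(h = 0 ∧ k = 0) → |(h : ℝ)| ≤ (M : ℝ) ^ (1 - γ) / 2 →
      |(k : ℝ)| ≤ (M : ℝ) ^ (1 / 25 : ℝ) → ∀ b c : ℝ,
      ‖∑ l ∈ range n, unitExp
        (h * ((M : ℝ) + (l : ℝ)) ^ γ + k * α * (l : ℝ) ^ 2 + b * (l : ℝ) + c)‖
        ≤ (M : ℝ) ^ (5 / 6 : ℝ) := by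
  filter_upwards [eventually_norm_sum_rpow_add_quadratic_le h0 h1,
    eventually_norm_sum_quadratic_le] with M hM1 hM2 n hn α a q hq h k hhk hh hk b c
  rcases lt_trichotomy h 0 with hneg | rfl | hpos
  · rw [← norm_sum_unitExp_neg]
    have e1 : (1 : ℝ) ≤ -h := by
      have : 1 ≤ -h := by omega
      exact_mod_cast this
    have := hM1 n hn (-h) e1 ((neg_le_abs _).trans hh) (-(k * α)) (-b) (-c)
    convert this using 5
    ring
  · have hk0 : k ≠ 0 := fun e => hhk ⟨rfl, e⟩
    have := hM2 n hn α a q hq k hk0 hk b c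
    simpa using this
  · exact hM1 n hn h (by exact_mod_cast hpos) ((le_abs_self _).trans hh) (k * α) b c

open Finset in
theorem sum_unitExp_mul_div (r m : ℕ) (hr : 0 < r) :
    ∑ b ∈ range r, unitExp (b * ((m : ℝ) / r)) = if r ∣ m then (r : ℂ) else 0 := by
  have hr0 : (r : ℝ) ≠ 0 := by positivity
  simp only [unitExp_nat_mul]
  split_ifs with h
  · obtain ⟨t, rfl⟩ := h
    have : unitExp (((r * t : ℕ) : ℝ) / r) = 1 := by
      rw [Nat.cast_mul, mul_div_cancel_left₀ _ hr0]
      exact_mod_cast unitExp_int t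
    simp only [this, one_pow, sum_const, card_range, nsmul_eq_mul, mul_one]
  · have hpow : unitExp ((m : ℝ) / r) ^ r = 1 := by
      rw [← unitExp_nat_mul, mul_div_cancel₀ _ hr0]
      exact_mod_cast unitExp_int m
    have hne : unitExp ((m : ℝ) / r) ≠ 1 := by
      intro h1
      rw [unitExp, Complex.exp_eq_one_iff] at h1
      obtain ⟨t, ht⟩ := h1
      apply h
      have h2 : ((m : ℝ) / r : ℝ) = t := by
        have hpi : (2 * Real.pi * Complex.I : ℂ) ≠ 0 := Complex.two_pi_I_ne_zero
        have : (((m : ℝ) / r : ℝ) : ℂ) = t := by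
          apply mul_right_cancel₀ hpi
          rw [← ht]
          push_cast
          ring
        exact_mod_cast this
      rw [div_eq_iff hr0] at h2
      have h3 : (m : ℤ) = t * r := by exact_mod_cast h2
      exact Int.natCast_dvd_natCast.1 ⟨t, by rw [h3, mul_comm]⟩
    rw [geom_sum_eq hne, hpow, sub_self, zero_div]

open Finset in
/-- Sums over multiples of `r` are controlled by sums twisted by a linear phase. -/
theorem norm_sum_dvd_le (F : ℕ → ℝ) (M n r : ℕ) (hr : 0 < r) {B : ℝ}
    (hB : ∀ b : ℕ, ‖∑ l ∈ range n, unitExp (F l + b * (((M + l : ℕ) : ℝ) / r))‖ ≤ B) :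
    ‖∑ l ∈ range n with r ∣ M + l, unitExp (F l)‖ ≤ B := by
  have hr0 : (0 : ℝ) < r := by exact_mod_cast hr
  have h1 : (r : ℂ) * ∑ l ∈ range n with r ∣ M + l, unitExp (F l) =
      ∑ b ∈ range r, ∑ l ∈ range n, unitExp (F l + b * (((M + l : ℕ) : ℝ) / r)) := by
    rw [sum_comm, sum_filter, mul_sum]
    refine sum_congr rfl fun l _ => ?_
    simp only [unitExp_add]
    rw [← mul_sum, sum_unitExp_mul_div _ _ hr]
    split_ifs
    · ring
    · simp
  have h2 : r * ‖∑ l ∈ range n with r ∣ M + l, unitExp (F l)‖ ≤ r * B := by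
    rw [← Complex.norm_natCast, ← norm_mul, h1]
    refine (norm_sum_le _ _).trans ((sum_le_sum fun b _ => hB b).trans ?_)
    simp
  exact le_of_mul_le_mul_left h2 hr0

/-- The (unnormalised) Fejér kernel. -/
noncomputable def fejer (H : ℕ) (x : ℝ) : ℝ := ‖∑ j ∈ Finset.range H, unitExp (j * x)‖ ^ 2

theorem fejer_nonneg (H : ℕ) (x : ℝ) : 0 ≤ fejer H x := sq_nonneg _

open Finset in
theorem sq_div_two_le_fejer {H : ℕ} {x D : ℝ} {m : ℤ} (hx : |x - m| ≤ D)
    (hH : ∀ j < H, (j : ℝ) * D ≤ 1 / 8) : (H : ℝ) ^ 2 / 2 ≤ fejer H x := by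
  have h1 : ∀ j ∈ range H, √2 / 2 ≤ (unitExp (j * x)).re := by
    intro j hj
    have h2 : unitExp (j * x) = unitExp (j * |x - m|) ∨
        unitExp (j * x) = unitExp (-(j * |x - m|)) := by
      have : unitExp (j * x) = unitExp (j * (x - m)) := by
        rw [← unitExp_sub_int (j * x) (j * m)]
        congr 1
        push_cast
        ring
      rw [this]
      rcases abs_choice (x - m) with h | h <;> rw [h]
      · exact Or.inl rfl
      · right
        congr 1
        ring
    have h3 : (unitExp (j * x)).re = Real.cos (2 * Real.pi * (j * |x - m|)) := by
      rcases h2 with h | h <;> rw [h, re_unitExp]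
      rw [mul_neg, Real.cos_neg]
    have h4 : (j : ℝ) * |x - m| ≤ 1 / 8 :=
      (mul_le_mul_of_nonneg_left hx (Nat.cast_nonneg j)).trans (hH j (mem_range.1 hj))
    rw [h3, ← Real.cos_pi_div_four]
    have hpi := Real.pi_pos
    refine Real.cos_le_cos_of_nonneg_of_le_pi (by positivity) (by linarith) ?_
    nlinarith
  have h2 : (H : ℝ) * (√2 / 2) ≤ ‖∑ j ∈ range H, unitExp (j * x)‖ := by
    refine le_trans ?_ (Complex.re_le_norm _)
    rw [Complex.re_sum, ← nsmul_eq_mul, ← card_range H, ← sum_const, card_range]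
    exact sum_le_sum h1
  calc (H : ℝ) ^ 2 / 2 = ((H : ℝ) * (√2 / 2)) ^ 2 := by
        rw [mul_pow, div_pow, Real.sq_sqrt (by norm_num)]; ring
    _ ≤ fejer H x := pow_le_pow_left₀ (by positivity) h2 2

open Finset in
theorem ofReal_fejer (H : ℕ) (x : ℝ) :
    (fejer H x : ℂ) = ∑ u ∈ range H ×ˢ range H, unitExp (((u.1 : ℤ) - (u.2 : ℤ) : ℤ) * x) := by
  rw [fejer, Complex.ofReal_pow, ← Complex.mul_conj', map_sum, sum_mul_sum, sum_product]
  refine sum_congr rfl fun j _ => sum_congr rfl fun i _ => ?_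
  rw [conj_unitExp, ← unitExp_add]
  congr 1
  push_cast
  ring

open Finset in
theorem abs_sum_fejer_mul_fejer_sub_le (s : Finset ℕ) (x y : ℕ → ℝ) (H K : ℕ) {B : ℝ}
    (hB0 : 0 ≤ B) (hB : ∀ h k : ℤ, ¬(h = 0 ∧ k = 0) → |h| < H → |k| < K →
      ‖∑ l ∈ s, unitExp (h * x l + k * y l)‖ ≤ B) :
    |∑ l ∈ s, fejer H (x l) * fejer K (y l) - #s * (H * K)| ≤ (H * K) ^ 2 * B := by
  set P := (range H ×ˢ range H) ×ˢ (range K ×ˢ range K) with hP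
  have h1 : ((∑ l ∈ s, fejer H (x l) * fejer K (y l) : ℝ) : ℂ) = ∑ u ∈ P, ∑ l ∈ s,
      unitExp (((u.1.1 : ℤ) - (u.1.2 : ℤ) : ℤ) * x l + ((u.2.1 : ℤ) - (u.2.2 : ℤ) : ℤ) * y l) := by
    rw [sum_comm, Complex.ofReal_sum]
    refine sum_congr rfl fun l _ => ?_
    rw [Complex.ofReal_mul, ofReal_fejer, ofReal_fejer, sum_mul_sum, hP,
      sum_product (range H ×ˢ range H) (range K ×ˢ range K)]
    simp only [unitExp_add]
  have h2 : ((#s * (H * K) : ℝ) : ℂ) =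
      ∑ u ∈ P, if u.1.1 = u.1.2 ∧ u.2.1 = u.2.2 then (#s : ℂ) else 0 := by
    have h3 : ∀ L : ℕ, ∑ u ∈ range L ×ˢ range L, (if u.1 = u.2 then (1 : ℂ) else 0) = L := by
      intro L
      rw [sum_product]
      simp only [sum_ite_eq]
      rw [sum_congr rfl fun i hi => if_pos hi]
      simp
    have h4 : ∀ u : (ℕ × ℕ) × ℕ × ℕ, (if u.1.1 = u.1.2 ∧ u.2.1 = u.2.2 then (#s : ℂ) else 0) =
        #s * ((if u.1.1 = u.1.2 then 1 else 0) * (if u.2.1 = u.2.2 then 1 else 0)) := by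
      intro u
      split_ifs <;> simp_all
    have h5 := sum_mul_sum (range H ×ˢ range H) (range K ×ˢ range K)
      (fun u => if u.1 = u.2 then (1 : ℂ) else 0) (fun u => if u.1 = u.2 then (1 : ℂ) else 0)
    rw [h3, h3] at h5
    rw [sum_congr rfl fun u _ => h4 u, ← mul_sum, hP,
      sum_product (range H ×ˢ range H) (range K ×ˢ range K), ← h5]
    push_cast
    ring
  have hcard : (#P : ℝ) = (H * K) ^ 2 := by
    rw [hP]
    simp only [card_product, card_range]
    push_cast
    ring
  rw [← Real.norm_eq_abs, ← Complex.norm_real, Complex.ofReal_sub, h1, h2, ← sum_sub_distrib,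
    ← hcard, ← nsmul_eq_mul]
  rw [← sum_const]
  refine norm_sum_le_of_le _ fun u hu => ?_
  simp only [hP, mem_product, mem_range] at hu
  split_ifs with h
  · simpa [h.1, h.2, unitExp_zero] using hB0
  · rw [sub_zero]
    refine hB _ _ ?_ ?_ ?_
    · omega
    · rw [abs_lt]; omega
    · rw [abs_lt]; omega

open Finset in
theorem abs_card_dvd_sub_le (M n r : ℕ) (hr : 0 < r) :
    |(#{l ∈ range n | r ∣ M + l} : ℝ) - n / r| ≤ 1 := by
  have h1 : #{l ∈ range n | r ∣ M + l} + (M + r - 1) / r = (M + n + r - 1) / r := by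
    induction n with
    | zero => simp
    | succ n ih =>
      rw [range_add_one, filter_insert]
      have h2 : (M + (n + 1) + r - 1) / r = (M + n + r - 1) / r + if r ∣ M + n then 1 else 0 := by
        have : M + (n + 1) + r - 1 = (M + n + r - 1) + 1 := by omega
        rw [this, Nat.succ_div]
        congr 1
        have : M + n + r - 1 + 1 = M + n + r := by omega
        rw [this]
        simp
      rw [h2, ← ih]
      split_ifs
      · rw [card_insert_of_notMem (by simp)]
        ring
      · ring
  have hr0 : (0 : ℝ) < r := by exact_mod_cast hr
  have h2 := Nat.div_mul_le_self (M + r - 1) r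
  have h3 := Nat.div_mul_le_self (M + n + r - 1) r
  have h4 := Nat.lt_div_mul_add (a := M + r - 1) hr
  have h5 := Nat.lt_div_mul_add (a := M + n + r - 1) hr
  rw [← h1] at h3 h5
  set c := #{l ∈ range n | r ∣ M + l}
  set d := (M + r - 1) / r
  have h6 : c * r ≤ n + r := by
    have : (c + d) * r = c * r + d * r := by ring
    omega
  have h7 : n ≤ c * r + r := by
    have : (c + d) * r = c * r + d * r := by ring
    omega
  have h6' : (c : ℝ) * r ≤ n + r := by exact_mod_cast h6
  have h7' : (n : ℝ) ≤ c * r + r := by exact_mod_cast h7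
  have h8 : (n : ℝ) / r * r = n := div_mul_cancel₀ _ hr0.ne'
  rw [abs_le]
  constructor <;> nlinarith

theorem abs_rpow_sub_le_of_eq_floor {γ : ℝ} (h0 : 0 < γ) (h1 : γ ≤ 1) {p k : ℕ} (hp : 0 < p)
    (hk : p = ⌊(k : ℝ) ^ (1 / γ)⌋₊) : |(p : ℝ) ^ γ - k| ≤ (p : ℝ) ^ (γ - 1) := by
  have hp0 : (0 : ℝ) < p := by exact_mod_cast hp
  have hk0 : (0 : ℝ) ≤ (k : ℝ) ^ (1 / γ) := by positivity
  have h2 : (p : ℝ) ≤ (k : ℝ) ^ (1 / γ) := by rw [hk]; exact Nat.floor_le hk0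
  have h3 : (k : ℝ) ^ (1 / γ) ≤ p + 1 := by rw [hk]; exact (Nat.lt_floor_add_one _).le
  have h4 : ((k : ℝ) ^ (1 / γ)) ^ γ = k := by
    rw [← Real.rpow_mul (Nat.cast_nonneg k), one_div_mul_cancel h0.ne', Real.rpow_one]
  have h5 : (p : ℝ) ^ γ ≤ k := h4 ▸ Real.rpow_le_rpow hp0.le h2 h0.le
  have h6 : (k : ℝ) ≤ (p + 1) ^ γ := by
    have := Real.rpow_le_rpow hk0 h3 h0.le
    rwa [h4] at this
  have h7 : ((p : ℝ) + 1) ^ γ ≤ (p : ℝ) ^ γ + (p : ℝ) ^ (γ - 1) := by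
    have e : (p : ℝ) + 1 = p * (1 + 1 / p) := by field_simp
    have h8 := rpow_one_add_le_one_add_mul_self (s := 1 / (p : ℝ))
      (by have : (0 : ℝ) ≤ 1 / p := by positivity
          linarith) h0.le h1
    rw [e, Real.mul_rpow hp0.le (by positivity), Real.rpow_sub_one hp0.ne']
    calc (p : ℝ) ^ γ * (1 + 1 / p) ^ γ ≤ (p : ℝ) ^ γ * (1 + 1 * (1 / p)) := by
          gcongr
          refine h8.trans ?_
          gcongr
      _ = (p : ℝ) ^ γ + (p : ℝ) ^ γ / p := by ring
  rw [abs_le]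
  constructor <;> linarith [Real.rpow_nonneg hp0.le (γ - 1)]

theorem exists_fejer_length {D : ℝ} (hD : 0 < D) :
    ∃ H : ℕ, 0 < H ∧ (∀ j < H, (j : ℝ) * D ≤ 1 / 8) ∧ 1 / (H : ℝ) ≤ 8 * D := by
  refine ⟨⌊1 / (8 * D)⌋₊ + 1, Nat.succ_pos _, fun j hj => ?_, ?_⟩
  · have : (j : ℝ) ≤ 1 / (8 * D) :=
      (Nat.cast_le.2 (Nat.lt_succ_iff.1 hj)).trans (Nat.floor_le (by positivity))
    rw [le_div_iff₀ (by positivity)] at this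
    linarith
  · have := Nat.lt_floor_add_one (1 / (8 * D))
    rw [one_div_le (by positivity) (by positivity)]
    push_cast
    exact this.le

/-- `p` is a Piatetski-Shapiro prime and `α * p ^ 2 + β` is within `D` of an integer. -/
def IsNearPSPrime (γ α β D : ℝ) (p : ℕ) : Prop :=
  p.Prime ∧ (∃ k : ℕ, 0 < k ∧ p = ⌊(k : ℝ) ^ (1 / γ)⌋₊) ∧ ∃ m : ℤ, |α * (p : ℝ) ^ 2 + β - m| ≤ D

open Finset in
theorem sum_Ico_filter_dvd {R : Type*} [AddCommMonoid R] (f : ℕ → R) (M n r : ℕ) :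
    ∑ m ∈ Ico M (M + n) with r ∣ m, f m = ∑ l ∈ range n with r ∣ M + l, f (M + l) := by
  rw [sum_filter, sum_filter, sum_Ico_eq_sum_range, Nat.add_sub_cancel_left]

open Filter Finset in
theorem eventually_abs_sum_fejer_sub_le {γ : ℝ} (h0 : 13 / 14 < γ) (h1 : γ < 1) :
    ∀ᶠ M : ℕ in atTop, ∀ n ≤ M, ∀ (α β : ℝ) (a : ℤ) (q : ℕ), GoodApprox α a q M →
      ∀ H K : ℕ, 0 < H → 0 < K → (∀ j < H, (j : ℝ) * (M : ℝ) ^ (γ - 1) ≤ 1 / 8) →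
      (∀ j < K, (j : ℝ) ≤ (M : ℝ) ^ (1 / 25 : ℝ)) → ∀ r : ℕ, 1 ≤ r →
      |∑ m ∈ Ico M (M + n) with r ∣ m, 4 / (H * K : ℝ) ^ 2 *
        (fejer H ((m : ℝ) ^ γ) * fejer K (α * (m : ℝ) ^ 2 + β)) - (4 * n / (H * K) / r : ℝ)|
        ≤ 8 * (M : ℝ) ^ (5 / 6 : ℝ) := by
  filter_upwards [eventually_norm_sum_le h0 h1, eventually_ge_atTop 1]
    with M hM hM1 n hn α β a q hq H K hH hK hHM hKM r hr
  have hM1' : (1 : ℝ) ≤ M := by exact_mod_cast hM1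
  have hM0 : (0 : ℝ) < M := by linarith
  have hH1 : (1 : ℝ) ≤ H := by exact_mod_cast hH
  have hK1 : (1 : ℝ) ≤ K := by exact_mod_cast hK
  have hr0 : (0 : ℝ) < r := by exact_mod_cast hr
  set s := {l ∈ range n | r ∣ M + l} with hs
  set T := ∑ l ∈ s, fejer H (((M + l : ℕ) : ℝ) ^ γ) * fejer K (α * ((M + l : ℕ) : ℝ) ^ 2 + β)
    with hT
  have key : |T - #s * (H * K)| ≤ (H * K) ^ 2 * (M : ℝ) ^ (5 / 6 : ℝ) := by
    refine abs_sum_fejer_mul_fejer_sub_le s (fun l => ((M + l : ℕ) : ℝ) ^ γ)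
      (fun l => α * ((M + l : ℕ) : ℝ) ^ 2 + β) H K (by positivity) fun h k hhk hh hk => ?_
    refine norm_sum_dvd_le _ M n r hr fun b => ?_
    have hh' : |(h : ℝ)| ≤ (M : ℝ) ^ (1 - γ) / 2 := by
      have := hHM h.natAbs (by zify; exact hh)
      rw [Nat.cast_natAbs, Int.cast_abs, ← neg_sub 1 γ, Real.rpow_neg hM0.le, ← div_eq_mul_inv,
        div_le_iff₀ (by positivity)] at this
      linarith [Real.rpow_nonneg hM0.le (1 - γ)]
    have hk' : |(k : ℝ)| ≤ (M : ℝ) ^ (1 / 25 : ℝ) := by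
      have := hKM k.natAbs (by zify; exact hk)
      rwa [Nat.cast_natAbs, Int.cast_abs] at this
    have := hM n hn α a q hq h k hhk hh' hk' (2 * k * α * M + b / r)
      (k * α * M ^ 2 + k * β + b * M / r)
    convert this using 4 with l
    push_cast
    ring
  have hc := abs_card_dvd_sub_le M n r hr
  rw [sum_Ico_filter_dvd, ← mul_sum, ← hs, ← hT]
  have hHK : (1 : ℝ) ≤ H * K := one_le_mul_of_one_le_of_one_le hH1 hK1
  have hHK0 : (0 : ℝ) < H * K := by linarith
  have e : 4 / ((H : ℝ) * K) ^ 2 * T - 4 * n / (H * K) / r =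
      4 / ((H : ℝ) * K) ^ 2 * (T - #s * (H * K)) + 4 / (H * K) * (#s - n / r) := by
    field_simp
    ring
  have hB : (1 : ℝ) ≤ (M : ℝ) ^ (5 / 6 : ℝ) := Real.one_le_rpow hM1' (by norm_num)
  rw [e]
  refine (abs_add_le _ _).trans ?_
  rw [abs_mul, abs_mul, abs_of_pos (show 0 < 4 / ((H : ℝ) * K) ^ 2 by positivity),
    abs_of_pos (show 0 < 4 / ((H : ℝ) * K) by positivity)]
  have i1 : 4 / ((H : ℝ) * K) ^ 2 * |T - #s * (H * K)| ≤ 4 * (M : ℝ) ^ (5 / 6 : ℝ) := by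
    rw [div_mul_eq_mul_div, div_le_iff₀ (by positivity)]
    linarith
  have i2 : 4 / ((H : ℝ) * K) * |(#s : ℝ) - n / r| ≤ 4 * 1 := by
    gcongr
    exact div_le_self (by norm_num) hHK
  linarith

open Filter Finset Classical in
theorem eventually_sum_isNearPSPrime_log_le {γ : ℝ} (h0 : 13 / 14 < γ) (h1 : γ < 1) :
    ∀ᶠ M : ℕ in atTop, ∀ n ≤ M, ∀ (α β : ℝ) (a : ℤ) (q : ℕ), GoodApprox α a q M →
      ∀ D : ℝ, (M : ℝ) ^ (-(1 / 25) : ℝ) ≤ D →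
      ∑ p ∈ Ico M (M + n) with IsNearPSPrime γ α β D p, Real.log p ≤
        409601 * (D * (M : ℝ) ^ γ) := by
  have h2 := (eventually_mul_log_pow_le_rpow 16 1
    (show (17 / 20 : ℝ) < 22 / 25 by norm_num)).natCast_atTop
  filter_upwards [eventually_abs_sum_fejer_sub_le h0 h1, h2, eventually_ge_atTop 2]
    with M hM hMl hM2 n hn α β a q hq D hD
  have hM2' : (2 : ℝ) ≤ M := by exact_mod_cast hM2
  have hM0 : (0 : ℝ) < M := by linarith
  have hD0 : 0 < D := lt_of_lt_of_le (by positivity) hD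
  have hlog : 0 < Real.log M := Real.log_pos (by linarith)
  obtain ⟨H, hH, hHj, hH8⟩ := exists_fejer_length (D := (M : ℝ) ^ (γ - 1)) (by positivity)
  obtain ⟨K, hK, hKj, hK8⟩ := exists_fejer_length hD0
  have hKM : ∀ j < K, (j : ℝ) ≤ (M : ℝ) ^ (1 / 25 : ℝ) := by
    intro j hj
    have h3 := (mul_le_mul_of_nonneg_left hD (Nat.cast_nonneg j)).trans (hKj j hj)
    rw [Real.rpow_neg hM0.le, ← div_eq_mul_inv, div_le_iff₀ (by positivity)] at h3
    linarith [Real.rpow_nonneg hM0.le (1 / 25 : ℝ)]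
  have hH0 : (0 : ℝ) < H := by exact_mod_cast hH
  have hK0 : (0 : ℝ) < K := by exact_mod_cast hK
  set w : ℕ → ℝ := fun m => 4 / (H * K : ℝ) ^ 2 *
        (fejer H ((m : ℝ) ^ γ) * fejer K (α * (m : ℝ) ^ 2 + β)) with hw
  have hw0 : ∀ m, 0 ≤ w m := fun m =>
    mul_nonneg (by positivity) (mul_nonneg (fejer_nonneg _ _) (fejer_nonneg _ _))
  have hw1 : ∀ p, M ≤ p → IsNearPSPrime γ α β D p → 1 ≤ w p := by
    rintro p hp ⟨-, ⟨k, -, hk⟩, m, hm⟩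
    have hp0 : 0 < p := by omega
    have i1 : |(p : ℝ) ^ γ - (k : ℤ)| ≤ (M : ℝ) ^ (γ - 1) :=
      (abs_rpow_sub_le_of_eq_floor (by linarith) h1.le hp0 hk).trans
        (Real.rpow_le_rpow_of_nonpos hM0 (by exact_mod_cast hp) (by linarith))
    have i2 := sq_div_two_le_fejer i1 hHj
    have i3 := sq_div_two_le_fejer hm hKj
    calc (1 : ℝ) = 4 / (H * K : ℝ) ^ 2 * ((H : ℝ) ^ 2 / 2 * ((K : ℝ) ^ 2 / 2)) := by
          field_simp; norm_num
      _ ≤ w p := by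
          simp only [hw]
          gcongr
          exact fejer_nonneg _ _
  set z := ⌊(M : ℝ) ^ (1 / 400 : ℝ)⌋₊ with hz
  have hz1 : 1 ≤ z := Nat.le_floor (by exact_mod_cast Real.one_le_rpow (by linarith) (by norm_num))
  have hzM : (z : ℝ) ≤ (M : ℝ) ^ (1 / 400 : ℝ) := Nat.floor_le (by positivity)
  have hzlt : z < M := by
    have : (M : ℝ) ^ (1 / 400 : ℝ) < (M : ℝ) ^ (1 : ℝ) :=
      Real.rpow_lt_rpow_of_exponent_lt (by linarith) (by norm_num)
    rw [Real.rpow_one] at this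
    exact_mod_cast hzM.trans_lt this
  have hzl : Real.log M / 400 ≤ Real.log (z + 1) := by
    have := Real.log_le_log (by positivity) (Nat.lt_floor_add_one ((M : ℝ) ^ (1 / 400 : ℝ))).le
    rw [Real.log_rpow hM0] at this
    rw [hz]
    linarith
  have sieve := sum_primes_le_of_equidistributed (Ico M (M + n)) w (fun m _ => hw0 m)
    (4 * n / (H * K)) (8 * (M : ℝ) ^ (5 / 6 : ℝ))
    (hM n hn α β a q hq H K hH hK hHj hKM) (by positivity) z hz1
  have hX : 4 * (n : ℝ) / (H * K) ≤ 256 * (D * (M : ℝ) ^ γ) := by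
    have e : (M : ℝ) ^ γ = M * (M : ℝ) ^ (γ - 1) := by
      rw [mul_comm, ← Real.rpow_add_one hM0.ne']; congr 1; ring
    calc 4 * (n : ℝ) / (H * K) = 4 * n * ((1 / H) * (1 / K)) := by field_simp
      _ ≤ 4 * M * ((8 * (M : ℝ) ^ (γ - 1)) * (8 * D)) := by gcongr
      _ = 256 * (D * (M : ℝ) ^ γ) := by rw [e]; ring
  have hmain : 2 * (4 * (n : ℝ) / (H * K)) / Real.log (z + 1) ≤
      204800 * (D * (M : ℝ) ^ γ) / Real.log M := by
    calc 2 * (4 * (n : ℝ) / (H * K)) / Real.log (z + 1)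
        ≤ 2 * (256 * (D * (M : ℝ) ^ γ)) / (Real.log M / 400) := by gcongr
      _ = _ := by field_simp; norm_num
  have herr : (z : ℝ) ^ 6 * (8 * (M : ℝ) ^ (5 / 6 : ℝ)) ≤ 8 * (M : ℝ) ^ (17 / 20 : ℝ) := by
    calc (z : ℝ) ^ 6 * (8 * (M : ℝ) ^ (5 / 6 : ℝ))
        ≤ ((M : ℝ) ^ (1 / 400 : ℝ)) ^ 6 * (8 * (M : ℝ) ^ (5 / 6 : ℝ)) := by gcongr
      _ = 8 * (M : ℝ) ^ (509 / 600 : ℝ) := by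
          rw [← Real.rpow_natCast, ← Real.rpow_mul hM0.le, mul_left_comm, ← Real.rpow_add hM0]
          norm_num
      _ ≤ _ := by
          have := Real.rpow_le_rpow_of_exponent_le (show (1 : ℝ) ≤ M by linarith)
            (show (509 / 600 : ℝ) ≤ 17 / 20 by norm_num)
          linarith
  have herr2 : 16 * ((M : ℝ) ^ (17 / 20 : ℝ) * (1 + Real.log M)) ≤ D * (M : ℝ) ^ γ := by
    rw [pow_one] at hMl
    calc _ ≤ (M : ℝ) ^ (22 / 25 : ℝ) := hMl
      _ ≤ (M : ℝ) ^ (-(1 / 25) + γ : ℝ) :=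
          Real.rpow_le_rpow_of_exponent_le (by linarith) (by linarith)
      _ = (M : ℝ) ^ (-(1 / 25) : ℝ) * (M : ℝ) ^ γ := Real.rpow_add hM0 _ _
      _ ≤ _ := by gcongr
  have hlogp : ∀ p ∈ Ico M (M + n), Real.log p ≤ 2 * Real.log M := by
    intro p hp
    rw [mem_Ico] at hp
    have hpM : p ≤ M ^ 2 := by nlinarith
    calc Real.log p ≤ Real.log ((M : ℝ) ^ 2) :=
          Real.log_le_log (by exact_mod_cast (by omega : 0 < p)) (by exact_mod_cast hpM)
      _ = 2 * Real.log M := by rw [Real.log_pow]; norm_num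
  have hsum : ∑ p ∈ Ico M (M + n) with IsNearPSPrime γ α β D p, Real.log p ≤
      2 * Real.log M * ∑ p ∈ Ico M (M + n) with p.Prime ∧ z < p, w p := by
    rw [mul_sum]
    refine (sum_le_sum fun p hp => ?_).trans (sum_le_sum_of_subset_of_nonneg ?_
      fun p _ _ => mul_nonneg (by positivity) (hw0 p))
    · rw [mem_filter] at hp
      have := hw1 p (mem_Ico.1 hp.1).1 hp.2
      have := hlogp p hp.1
      nlinarith
    · intro p hp
      rw [mem_filter] at hp ⊢
      exact ⟨hp.1, hp.2.1, hzlt.trans_le (mem_Ico.1 hp.1).1⟩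
  calc _ ≤ 2 * Real.log M * (204800 * (D * (M : ℝ) ^ γ) / Real.log M +
        8 * (M : ℝ) ^ (17 / 20 : ℝ)) := by
        refine hsum.trans ?_
        gcongr
        linarith
    _ = 409600 * (D * (M : ℝ) ^ γ) + 16 * ((M : ℝ) ^ (17 / 20 : ℝ) * Real.log M) := by
        field_simp; ring
    _ ≤ _ := by linarith [Real.rpow_nonneg hM0.le (17 / 20 : ℝ)]

open Finset in
theorem sum_range_le_of_dyadic {f : ℕ → ℝ} {γ A C : ℝ} (hγ : 1 / 2 ≤ γ) (hA : 0 ≤ A) {X N : ℕ}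
    (hX : 1 ≤ X) (hf : ∀ M, X ≤ M → M ≤ N → ∀ n ≤ M, ∑ p ∈ Ico M (M + n), f p ≤ A * (M : ℝ) ^ γ)
    (hC : ∀ y < 2 * X, ∑ p ∈ range (y + 1), f p ≤ C) (y : ℕ) (hy : y ≤ N) :
    ∑ p ∈ range (y + 1), f p ≤ C + 4 * A * (y : ℝ) ^ γ := by
  induction y using Nat.strong_induction_on with
  | _ y ih =>
  rcases lt_or_ge y (2 * X) with h | h
  · have := hC y h
    have : 0 ≤ 4 * A * (y : ℝ) ^ γ := by positivity
    linarith
  · have h1 := ih (y / 2) (by omega) (by omega)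
    have h2 := hf (y / 2 + 1) (by omega) (by omega) (y - y / 2) (by omega)
    have h3 : ((y / 2 + 1 : ℕ) : ℝ) ^ γ ≤ (y : ℝ) ^ γ :=
      Real.rpow_le_rpow (Nat.cast_nonneg _) (Nat.cast_le.2 (by omega)) (by linarith)
    have h4 : ((y / 2 : ℕ) : ℝ) ^ γ ≤ 3 / 4 * (y : ℝ) ^ γ := by
      have e1 : ((y / 2 : ℕ) : ℝ) ≤ y / 2 := Nat.cast_div_le
      have e2 : (1 / 2 : ℝ) ^ γ ≤ 3 / 4 := by
        calc (1 / 2 : ℝ) ^ γ ≤ (1 / 2 : ℝ) ^ (1 / 2 : ℝ) :=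
              Real.rpow_le_rpow_of_exponent_ge (by norm_num) (by norm_num) hγ
          _ ≤ 3 / 4 := by
              rw [← Real.sqrt_eq_rpow]
              exact Real.sqrt_le_iff.2 ⟨by norm_num, by norm_num⟩
      calc ((y / 2 : ℕ) : ℝ) ^ γ ≤ (1 / 2 * (y : ℝ)) ^ γ :=
            Real.rpow_le_rpow (Nat.cast_nonneg _) (by linarith) (by linarith)
        _ = (1 / 2 : ℝ) ^ γ * (y : ℝ) ^ γ := Real.mul_rpow (by norm_num) (Nat.cast_nonneg _)
        _ ≤ _ := by gcongr
    have h5 : ∑ p ∈ range (y + 1), f p =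
        ∑ p ∈ range (y / 2 + 1), f p + ∑ p ∈ Ico (y / 2 + 1) (y / 2 + 1 + (y - y / 2)), f p := by
      rw [sum_range_add_sum_Ico _ (by omega)]
      congr 2
      omega
    rw [h5]
    calc _ ≤ C + 4 * A * ((y / 2 : ℕ) : ℝ) ^ γ + A * ((y / 2 + 1 : ℕ) : ℝ) ^ γ := add_le_add h1 h2
      _ ≤ C + 4 * A * (3 / 4 * (y : ℝ) ^ γ) + A * (y : ℝ) ^ γ := by gcongr
      _ = _ := by ring

open Filter Finset Classical in
theorem eventually_sum_range_isNearPSPrime_log_le {γ : ℝ} (h0 : 13 / 14 < γ) (h1 : γ < 1) :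
    ∀ᶠ N : ℝ in atTop, ∀ (α β : ℝ) (a : ℤ) (q : ℕ), Int.gcd a (q : ℤ) = 1 →
      |α - (a : ℝ) / (q : ℝ)| < 1 / (q : ℝ) ^ 2 → N ^ (27 / 29 : ℝ) ≤ q → (q : ℝ) ≤ N →
      ∀ D : ℝ, N ^ (-(1 / 29) : ℝ) ≤ D →
      ∑ p ∈ range (⌊N⌋₊ + 1) with IsNearPSPrime γ α β D p, Real.log p ≤
        1638405 * (D * N ^ γ) := by
  obtain ⟨M₀, hM₀⟩ := eventually_atTop.1 (eventually_sum_isNearPSPrime_log_le h0 h1)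
  have h2 := eventually_mul_log_pow_le_rpow 8 1
    (show (8 / 9 : ℝ) < 447 / 500 by norm_num)
  have h3 := (tendsto_rpow_atTop (show (0 : ℝ) < 8 / 9 by norm_num)).eventually_ge_atTop (M₀ : ℝ)
  filter_upwards [h2, h3, eventually_ge_atTop 1]
    with N hNl hNM hN1 α β a q hgcd hα hq1 hq2 D hD
  have hN0 : 0 < N := by linarith
  have hD0 : 0 < D := lt_of_lt_of_le (by positivity) hD
  have hlogN := Real.log_nonneg hN1
  set X := ⌈N ^ (8 / 9 : ℝ)⌉₊ with hX
  have hX1 : 1 ≤ X := Nat.one_le_ceil_iff.2 (by positivity)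
  have hXl : N ^ (8 / 9 : ℝ) ≤ X := Nat.le_ceil _
  have hN89 : 1 ≤ N ^ (8 / 9 : ℝ) := Real.one_le_rpow hN1 (by norm_num)
  have hXu : (X : ℝ) ≤ 2 * N ^ (8 / 9 : ℝ) := by
    have := (Nat.ceil_lt_add_one (show 0 ≤ N ^ (8 / 9 : ℝ) by positivity)).le
    linarith
  have hdy : ∀ M, X ≤ M → M ≤ ⌊N⌋₊ → ∀ n ≤ M,
      ∑ p ∈ Ico M (M + n), (if IsNearPSPrime γ α β D p then Real.log p else 0) ≤
        409601 * D * (M : ℝ) ^ γ := by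
    intro M hXM hMN n hn
    have hXM' : N ^ (8 / 9 : ℝ) ≤ M := hXl.trans (by exact_mod_cast hXM)
    have hMN' : (M : ℝ) ≤ N := (Nat.le_floor_iff hN0.le).1 hMN
    have hM0 : (0 : ℝ) ≤ M := Nat.cast_nonneg M
    have g1 : (M : ℝ) ^ (9 / 10 : ℝ) ≤ q := by
      calc (M : ℝ) ^ (9 / 10 : ℝ) ≤ N ^ (9 / 10 : ℝ) :=
            Real.rpow_le_rpow hM0 hMN' (by norm_num)
        _ ≤ N ^ (27 / 29 : ℝ) := Real.rpow_le_rpow_of_exponent_le hN1 (by norm_num)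
        _ ≤ q := hq1
    have g2 : (q : ℝ) ≤ (M : ℝ) ^ (9 / 8 : ℝ) := by
      calc (q : ℝ) ≤ N := hq2
        _ = (N ^ (8 / 9 : ℝ)) ^ (9 / 8 : ℝ) := by rw [← Real.rpow_mul hN0.le]; norm_num
        _ ≤ _ := Real.rpow_le_rpow (by positivity) hXM' (by norm_num)
    have g3 : (M : ℝ) ^ (-(1 / 25) : ℝ) ≤ D := by
      calc (M : ℝ) ^ (-(1 / 25) : ℝ) ≤ (N ^ (8 / 9 : ℝ)) ^ (-(1 / 25) : ℝ) :=
            Real.rpow_le_rpow_of_nonpos (by positivity) hXM' (by norm_num)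
        _ = N ^ (-(8 / 225) : ℝ) := by rw [← Real.rpow_mul hN0.le]; norm_num
        _ ≤ N ^ (-(1 / 29) : ℝ) := Real.rpow_le_rpow_of_exponent_le hN1 (by norm_num)
        _ ≤ D := hD
    rw [← sum_filter, mul_assoc]
    exact hM₀ M (by exact_mod_cast hNM.trans hXM') n hn α β a q ⟨hgcd, hα, g1, g2⟩ D g3
  have hsmall : ∀ y < 2 * X, ∑ p ∈ range (y + 1),
      (if IsNearPSPrime γ α β D p then Real.log p else 0) ≤ D * N ^ γ := by
    intro y hy
    have hyN : ((y + 1 : ℕ) : ℝ) ≤ 4 * N ^ (8 / 9 : ℝ) := by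
      have : ((y + 1 : ℕ) : ℝ) ≤ (2 * X : ℕ) := Nat.cast_le.2 hy
      push_cast at this ⊢
      linarith
    have hNN : N ^ (8 / 9 : ℝ) ≤ N := by
      simpa using Real.rpow_le_rpow_of_exponent_le hN1 (show (8 / 9 : ℝ) ≤ 1 by norm_num)
    have hl : ∀ p ∈ range (y + 1), (if IsNearPSPrime γ α β D p then Real.log p else 0) ≤
        2 * (1 + Real.log N) := by
      intro p hp
      split_ifs with h
      · have hp0 : (0 : ℝ) < p := by exact_mod_cast h.1.pos
        have hpy : (p : ℝ) ≤ (y + 1 : ℕ) := Nat.cast_le.2 (mem_range.1 hp).le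
        have hl4 : Real.log 4 ≤ 2 := by
          rw [show (4 : ℝ) = 2 ^ 2 by norm_num, Real.log_pow]
          push_cast
          linarith [Real.log_two_lt_d9]
        calc Real.log p ≤ Real.log (4 * N) := Real.log_le_log hp0 (by linarith)
          _ = Real.log 4 + Real.log N := Real.log_mul (by norm_num) hN0.ne'
          _ ≤ _ := by linarith
      · positivity
    rw [pow_one] at hNl
    calc _ ≤ ((y + 1 : ℕ) : ℝ) * (2 * (1 + Real.log N)) := by
          refine (sum_le_sum hl).trans_eq ?_
          rw [sum_const, card_range, nsmul_eq_mul]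
      _ ≤ 4 * N ^ (8 / 9 : ℝ) * (2 * (1 + Real.log N)) := by gcongr
      _ = 8 * (N ^ (8 / 9 : ℝ) * (1 + Real.log N)) := by ring
      _ ≤ N ^ (447 / 500 : ℝ) := hNl
      _ ≤ N ^ (-(1 / 29) + γ : ℝ) := Real.rpow_le_rpow_of_exponent_le hN1 (by linarith)
      _ = N ^ (-(1 / 29) : ℝ) * N ^ γ := Real.rpow_add hN0 _ _
      _ ≤ D * N ^ γ := by gcongr
  rw [sum_filter]
  calc _ ≤ D * N ^ γ + 4 * (409601 * D) * ((⌊N⌋₊ : ℕ) : ℝ) ^ γ :=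
        sum_range_le_of_dyadic (by linarith) (by positivity) hX1 hdy hsmall _ le_rfl
    _ ≤ D * N ^ γ + 4 * (409601 * D) * N ^ γ := by
        gcongr
        · exact Nat.floor_le hN0.le
    _ = _ := by ring

theorem exists_abs_sub_le_of_Fdelta_ne_zero {Δ θ : ℝ} (h : Fdelta Δ θ ≠ 0) :
    ∃ m : ℤ, |θ - m| ≤ Δ := by
  unfold Fdelta at h
  split_ifs at h with h1
  · refine ⟨⌊θ + 1 / 2⌋, ?_⟩
    have h2 := Int.self_sub_floor (θ + 1 / 2)
    rw [abs_le]
    constructor <;> linarith [h1.1, h1.2]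
  · exact absurd rfl h

theorem Fdelta_mem_Icc (Δ θ : ℝ) : Fdelta Δ θ ∈ Set.Icc (0 : ℝ) 1 := by
  unfold Fdelta
  split_ifs <;> simp

open Finset Classical in
theorem abs_sum_psPrimes_le (γ N α β : ℝ) {Δ : ℝ} (hΔ : 0 ≤ Δ) :
    |∑ p ∈ psPrimes γ N, (Fdelta Δ (α * (p : ℝ) ^ 2 + β) - 2 * Δ) * Real.log p| ≤
      ∑ p ∈ range (⌊N⌋₊ + 1) with IsNearPSPrime γ α β Δ p, Real.log p +
        2 * Δ * ∑ p ∈ range (⌊N⌋₊ + 1) with IsNearPSPrime γ α β 1 p, Real.log p := by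
  have hlog : ∀ p : ℕ, 0 ≤ Real.log p := fun p => Real.log_natCast_nonneg p
  have h1 : ∑ p ∈ psPrimes γ N, Fdelta Δ (α * (p : ℝ) ^ 2 + β) * Real.log p ≤
      ∑ p ∈ range (⌊N⌋₊ + 1) with IsNearPSPrime γ α β Δ p, Real.log p := by
    rw [psPrimes, sum_filter, sum_filter]
    refine sum_le_sum fun p _ => ?_
    have hF := Fdelta_mem_Icc Δ (α * (p : ℝ) ^ 2 + β)
    by_cases hp : p.Prime ∧ ∃ n : ℕ, 0 < n ∧ p = ⌊(n : ℝ) ^ (1 / γ)⌋₊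
    · rw [if_pos hp]
      by_cases hz : Fdelta Δ (α * (p : ℝ) ^ 2 + β) = 0
      · rw [hz, zero_mul]
        split_ifs
        exacts [hlog p, le_rfl]
      · rw [if_pos ⟨hp.1, hp.2, exists_abs_sub_le_of_Fdelta_ne_zero hz⟩]
        exact mul_le_of_le_one_left (hlog p) hF.2
    · rw [if_neg hp]
      split_ifs
      exacts [hlog p, le_rfl]
  have h2 : ∑ p ∈ psPrimes γ N, Real.log p ≤
      ∑ p ∈ range (⌊N⌋₊ + 1) with IsNearPSPrime γ α β 1 p, Real.log p := by
    refine sum_le_sum_of_subset_of_nonneg (fun p hp => ?_) fun p _ _ => hlog p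
    rw [psPrimes, mem_filter] at hp
    exact mem_filter.2 ⟨hp.1, hp.2.1, hp.2.2, round (α * (p : ℝ) ^ 2 + β),
      (abs_sub_round _).trans (by norm_num)⟩
  have h3 : 0 ≤ ∑ p ∈ psPrimes γ N, Fdelta Δ (α * (p : ℝ) ^ 2 + β) * Real.log p :=
    sum_nonneg fun p _ => mul_nonneg (Fdelta_mem_Icc _ _).1 (hlog p)
  have h4 : 0 ≤ ∑ p ∈ psPrimes γ N, Real.log p := sum_nonneg fun p _ => hlog p
  simp only [sub_mul, sum_sub_distrib, ← mul_sum]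
  have h5 : 0 ≤ 2 * Δ * ∑ p ∈ psPrimes γ N, Real.log p := by positivity
  have h6 : 2 * Δ * ∑ p ∈ psPrimes γ N, Real.log p ≤
      2 * Δ * ∑ p ∈ range (⌊N⌋₊ + 1) with IsNearPSPrime γ α β 1 p, Real.log p := by gcongr
  rw [abs_le]
  constructor <;> linarith

theorem Gamma_bound (γ ε : ℝ) (hγ1 : 13 / 14 < γ) (hγ2 : γ < 1) (hε : 0 < ε) :
    ∃ C₀ > 0, ∀ C ≥ C₀, ∃ K > 0, ∃ q₀ : ℕ, ∀ (α β : ℝ) (a : ℤ) (q : ℕ),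
      Irrational α → q₀ ≤ q → 2 ≤ q → Int.gcd a (q : ℤ) = 1 → a ≠ 0 →
      |α - (a : ℝ) / (q : ℝ)| < 1 / (q : ℝ) ^ 2 →
      |∑ p ∈ psPrimes γ ((q : ℝ) ^ (29 / (55 - 28 * γ))),
          (Fdelta (C * ((q : ℝ) ^ (29 / (55 - 28 * γ))) ^ ((13 - 14 * γ) / 29 + ε))
              (α * (p : ℝ) ^ 2 + β) -
            2 * (C * ((q : ℝ) ^ (29 / (55 - 28 * γ))) ^ ((13 - 14 * γ) / 29 + ε))) *
            Real.log p| ≤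
        K * ((q : ℝ) ^ (29 / (55 - 28 * γ))) ^ ((15 * γ + 13) / 29 + ε) := by
  refine ⟨1, one_pos, fun C hC => ⟨4915215 * C, by linarith, ?_⟩⟩
  have hexp : 0 < 29 / (55 - 28 * γ) := div_pos (by norm_num) (by linarith)
  obtain ⟨q₀, hq₀⟩ := Filter.eventually_atTop.1
    (((tendsto_rpow_atTop hexp).comp tendsto_natCast_atTop_atTop).eventually
      ((eventually_sum_range_isNearPSPrime_log_le hγ1 hγ2).and (Filter.eventually_ge_atTop 1)))
  refine ⟨q₀, fun α β a q _ hq _ hgcd _ hα => ?_⟩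
  obtain ⟨hsum, hN1⟩ := hq₀ q hq
  simp only [Function.comp_apply] at hsum hN1
  have hqN : (q : ℝ) = ((q : ℝ) ^ (29 / (55 - 28 * γ))) ^ ((55 - 28 * γ) / 29) := by
    have : (55 - 28 * γ) ≠ 0 := by linarith
    rw [← Real.rpow_mul (Nat.cast_nonneg q), div_mul_div_cancel₀ this, div_self (by norm_num),
      Real.rpow_one]
  generalize (q : ℝ) ^ (29 / (55 - 28 * γ)) = N at *
  have hN0 : 0 < N := by linarith
  have hq1 : N ^ (27 / 29 : ℝ) ≤ q := by
    rw [hqN]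
    exact Real.rpow_le_rpow_of_exponent_le hN1 (by linarith)
  have hq2 : (q : ℝ) ≤ N := by
    rw [hqN]
    simpa using Real.rpow_le_rpow_of_exponent_le hN1 (show (55 - 28 * γ) / 29 ≤ 1 by linarith)
  set Δ := C * N ^ ((13 - 14 * γ) / 29 + ε) with hΔ
  have hΔN : N ^ (-(1 / 29) : ℝ) ≤ Δ := by
    calc N ^ (-(1 / 29) : ℝ) ≤ N ^ ((13 - 14 * γ) / 29 + ε) :=
          Real.rpow_le_rpow_of_exponent_le hN1 (by linarith)
      _ ≤ Δ := le_mul_of_one_le_left (by positivity) hC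
  have hΔ0 : 0 ≤ Δ := le_trans (by positivity) hΔN
  have b1 := hsum α β a q hgcd hα hq1 hq2 Δ hΔN
  have b2 := hsum α β a q hgcd hα hq1 hq2 1 (Real.rpow_le_one_of_one_le_of_nonpos hN1 (by norm_num))
  calc _ ≤ _ := abs_sum_psPrimes_le γ N α β hΔ0
    _ ≤ 1638405 * (Δ * N ^ γ) + 2 * Δ * (1638405 * (1 * N ^ γ)) := by gcongr
    _ = 4915215 * C * (N ^ ((13 - 14 * γ) / 29 + ε) * N ^ γ) := by rw [hΔ]; ring
    _ = 4915215 * C * N ^ ((15 * γ + 13) / 29 + ε) := by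
        rw [← Real.rpow_add hN0]
        congr 2
        ring
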